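/- arXiv:1410.7150 — 4 statements merged into one kernel-verified Lean document; each statement's English description precedes it below -/
import Mathlib

section
/- Let p ≥ 3 be an integer and let i ∈ {1,…,p−1} be coprime to p. For n ∈ ℕ let Sym(p, i+np) be the number of symmetric numerical semigroups containing both p and i+np. Then n ↦ Sym(p, i+np) is a quasi-polynomial of degree ⌊p/2⌋ whose leading coefficient is constant (the coefficient of T^{⌊p/2⌋} is the same in all constituent polynomials). -/
/-- A numerical semigroup: a submonoid of (ℕ,+) with finite complement. -/
def IsNumericalSemigroup (H : Set ℕ) : Prop :=
  0 ∈ H ∧ (∀ a ∈ H, ∀ b ∈ H, a + b ∈ H) ∧ Hᶜ.Finite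

/-- The genus: number of gaps. -/
noncomputable def genus (H : Set ℕ) : ℕ := Hᶜ.ncard

/-- The Frobenius number, as an integer (so that F(ℕ) = -1). -/
noncomputable def frobNum (H : Set ℕ) : ℤ :=
  sSup (insert (-1) ((fun n : ℕ => (n : ℤ)) '' Hᶜ))

/-- `H` is symmetric if `2 g(H) = F(H) + 1`. -/
def IsSymmetricNS (H : Set ℕ) : Prop := 2 * (genus H : ℤ) = frobNum H + 1

/-- `Sym p q`: the number of symmetric numerical semigroups containing both `p` and `q`. -/
noncomputable def countSym (p q : ℕ) : ℕ :=
  {H : Set ℕ | IsNumericalSemigroup H ∧ p ∈ H ∧ q ∈ H ∧ IsSymmetricNS H}.ncard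

section

open Finset

/-- A function on `ℤ` with some positive period. -/
def IsPeriodicFn (g : ℤ → ℝ) : Prop := ∃ N : ℕ, 0 < N ∧ Function.Periodic g (N : ℤ)

namespace IsPeriodicFn

lemma const (c : ℝ) : IsPeriodicFn fun _ => c := ⟨1, one_pos, fun _ => rfl⟩

lemma mul {f g : ℤ → ℝ} (hf : IsPeriodicFn f) (hg : IsPeriodicFn g) :
    IsPeriodicFn fun t => f t * g t := by
  obtain ⟨M, hM, hf⟩ := hf
  obtain ⟨N, hN, hg⟩ := hg
  refine ⟨M * N, Nat.mul_pos hM hN, fun t => ?_⟩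
  have h1 : f (t + (N : ℤ) * M) = f t := hf.int_mul N t
  have h2 : g (t + (M : ℤ) * N) = g t := hg.int_mul M t
  push_cast
  rw [h2, mul_comm (M : ℤ), h1]

lemma comp_affine {g : ℤ → ℝ} (hg : IsPeriodicFn g) (b c : ℤ) :
    IsPeriodicFn fun t => g (c + b * t) := by
  obtain ⟨N, hN, hg⟩ := hg
  refine ⟨N, hN, fun t => ?_⟩
  have h := hg.int_mul b (c + b * t)
  simp only
  rw [← h]
  congr 1
  push_cast
  ring

lemma comp_ediv {g : ℤ → ℝ} (hg : IsPeriodicFn g) (e : ℤ) {B : ℤ} (hB : 0 < B) :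
    IsPeriodicFn fun t => g ((t - e) / B) := by
  obtain ⟨N, hN, hg⟩ := hg
  refine ⟨N * B.toNat, Nat.mul_pos hN (by omega), fun t => ?_⟩
  have : (t + ((N * B.toNat : ℕ) : ℤ) - e) / B = (t - e) / B + N := by
    push_cast
    rw [Int.toNat_of_nonneg hB.le, ← Int.add_mul_ediv_right _ _ hB.ne']
    congr 1
    ring
  simp only [this]
  exact hg _

lemma emod {B : ℤ} (hB : 0 < B) (e : ℤ) : IsPeriodicFn fun t => (((t - e) % B : ℤ) : ℝ) := by
  refine ⟨B.toNat, by omega, fun t => ?_⟩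
  simp only
  rw [Int.toNat_of_nonneg hB.le, show t + B - e = t - e + B by ring, Int.add_emod_right]

end IsPeriodicFn

/-- The algebra of quasi-polynomial functions on `ℤ`. -/
def quasiPoly : Subalgebra ℝ (ℤ → ℝ) :=
  Algebra.adjoin ℝ ({fun t : ℤ => (t : ℝ)} ∪ {g | IsPeriodicFn g})

lemma cast_mem_quasiPoly : (fun t : ℤ => (t : ℝ)) ∈ quasiPoly :=
  Algebra.subset_adjoin (Or.inl rfl)

lemma IsPeriodicFn.mem_quasiPoly {g : ℤ → ℝ} (hg : IsPeriodicFn g) : g ∈ quasiPoly :=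
  Algebra.subset_adjoin (Or.inr hg)

lemma sub_sub_one_pow (k : ℕ) (t : ℝ) :
    t ^ k - (t - 1) ^ k = ∑ b ∈ range k, -((-1) ^ (k - b) * (k.choose b : ℝ)) * t ^ b := by
  rw [sub_eq_add_neg t 1, add_pow, sum_range_succ]
  simp only [Nat.sub_self, pow_zero, Nat.choose_self, Nat.cast_one, mul_one]
  rw [← sub_sub, sub_right_comm, sub_self, zero_sub, ← sum_neg_distrib]
  exact sum_congr rfl fun b _ => by ring

lemma exists_backwardDiff_periodic {g : ℤ → ℝ} (hg : IsPeriodicFn g) :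
    ∃ h : ℤ → ℝ, ∃ m : ℝ, IsPeriodicFn h ∧ ∀ t, h t - h (t - 1) = g t - m := by
  obtain ⟨N, hN, hg⟩ := hg
  have hper : Function.Periodic (fun t : ℤ => ∑ j ∈ range N, g (t + j)) 1 := by
    intro t
    have h1 := sum_range_succ' (fun j : ℕ => g (t + j)) N
    rw [sum_range_succ] at h1
    have h2 := hg t
    simp only [Nat.cast_add, Nat.cast_one, Nat.cast_zero, add_zero] at h1
    simp only [add_assoc, add_comm (1 : ℤ)]
    linarith
  have hconst : ∀ t : ℤ, ∑ j ∈ range N, g (t + j) = ∑ j ∈ range N, g j := by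
    intro t
    have := hper.int_mul_eq t
    simpa using this
  have hN' : (N : ℝ) ≠ 0 := by positivity
  refine ⟨fun t => (N : ℝ)⁻¹ * ∑ j ∈ range N, (j : ℝ) * g (t + 1 + j),
    (N : ℝ)⁻¹ * ∑ j ∈ range N, g j, ⟨N, hN, fun t => ?_⟩, fun t => ?_⟩
  · simp only
    congr 1
    refine sum_congr rfl fun j _ => ?_
    rw [← hg (t + 1 + j)]
    congr 2
    ring
  · simp only
    have h1 := sum_range_succ' (fun j : ℕ => (j : ℝ) * g (t + j)) N
    rw [sum_range_succ] at h1
    have h2 := hg t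
    have h3 := hconst (t + 1)
    simp only [Nat.cast_add, Nat.cast_one, Nat.cast_zero, zero_mul, add_zero, add_mul,
      sum_add_distrib, one_mul] at h1
    have e : ∀ j : ℕ, t + 1 + (j : ℤ) = t + (j + 1) := fun j => by ring
    simp only [e, sub_add_cancel] at h3 ⊢
    rw [h2] at h1
    rw [← h3]
    field_simp
    linarith

lemma exists_backwardDiff (k : ℕ) : ∀ g : ℤ → ℝ, IsPeriodicFn g →
    ∃ G ∈ quasiPoly, ∀ t : ℤ, G t - G (t - 1) = (t : ℝ) ^ k * g t := by
  induction k using Nat.strong_induction_on with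
  | _ k ih =>
  intro g hg
  obtain ⟨h, m, hh, hdiff⟩ := exists_backwardDiff_periodic hg
  have hlow : ∀ b : ℕ, ∃ G ∈ quasiPoly, b < k → ∀ t : ℤ, G t - G (t - 1) =
      (t : ℝ) ^ b * (-((-1) ^ (k - b) * (k.choose b : ℝ)) * h (-1 + 1 * t)) := by
    intro b
    by_cases hb : b < k
    · obtain ⟨G, hG, hG'⟩ := ih b hb _ ((IsPeriodicFn.const _).mul (hh.comp_affine 1 (-1)))
      exact ⟨G, hG, fun _ => hG'⟩
    · exact ⟨0, zero_mem _, fun h => absurd h hb⟩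
  have hlow' : ∀ b : ℕ, ∃ G ∈ quasiPoly, b < k → ∀ t : ℤ, G t - G (t - 1) =
      (t : ℝ) ^ b * (-((-1) ^ (k + 1 - b) * ((k + 1).choose b : ℝ)) * (m / (k + 1))) := by
    intro b
    by_cases hb : b < k
    · obtain ⟨G, hG, hG'⟩ := ih b hb _ (IsPeriodicFn.const _)
      exact ⟨G, hG, fun _ => hG'⟩
    · exact ⟨0, zero_mem _, fun h => absurd h hb⟩
  choose G hG hG' using hlow
  choose F hF hF' using hlow'
  refine ⟨(fun t : ℤ => (t : ℝ)) ^ k * h + (m / (k + 1)) • (fun t : ℤ => (t : ℝ)) ^ (k + 1)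
    - ∑ b ∈ range k, G b - ∑ b ∈ range k, F b, ?_, fun t => ?_⟩
  · exact sub_mem (sub_mem (add_mem (mul_mem (pow_mem cast_mem_quasiPoly _) hh.mem_quasiPoly)
      (Subalgebra.smul_mem _ (pow_mem cast_mem_quasiPoly _) _)) (sum_mem fun b _ => hG b))
      (sum_mem fun b _ => hF b)
  · have h1 : ∑ b ∈ range k, (G b t - G b (t - 1)) = ((t : ℝ) ^ k - (t - 1) ^ k) * h (t - 1) := by
      rw [sub_sub_one_pow, sum_mul]
      refine sum_congr rfl fun b hb => ?_
      rw [hG' b (mem_range.1 hb), show -1 + 1 * t = t - 1 by ring]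
      ring
    have h2 : ∑ b ∈ range k, (F b t - F b (t - 1)) =
        ((t : ℝ) ^ (k + 1) - (t - 1) ^ (k + 1)) * (m / (k + 1)) - m * t ^ k := by
      rw [sub_sub_one_pow, sum_range_succ, add_mul, sum_mul]
      have : (k : ℝ) + 1 ≠ 0 := by positivity
      have h3 : -((-1) ^ (k + 1 - k) * ((k + 1).choose k : ℝ)) * t ^ k * (m / (k + 1))
          = m * t ^ k := by
        simp only [Nat.add_sub_cancel_left, pow_one, Nat.choose_succ_self_right]
        push_cast
        field_simp
      rw [h3, add_sub_cancel_right]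
      refine sum_congr rfl fun b hb => ?_
      rw [hF' b (mem_range.1 hb)]
      ring
    rw [sum_sub_distrib] at h1 h2
    simp only [Pi.sub_apply, Pi.add_apply, Pi.mul_apply, Pi.pow_apply, Pi.smul_apply, smul_eq_mul,
      Finset.sum_apply]
    push_cast
    linear_combination (t : ℝ) ^ k * hdiff t - h1 - h2

lemma sum_Ioc_of_backwardDiff {G f : ℤ → ℝ} (h : ∀ t, G t - G (t - 1) = f t) {u v : ℤ}
    (huv : u ≤ v) : ∑ t ∈ Ioc u v, f t = G v - G u := by
  induction v, huv using Int.leInduction with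
  | base => simp
  | succ v huv ih =>
    have : Ioc u (v + 1) = insert (v + 1) (Ioc u v) := by
      ext x
      simp only [mem_Ioc, mem_insert]
      omega
    rw [this, sum_insert (by simp), ih, ← h (v + 1)]
    simp

/-- The algebra of functions on `V` generated by integer linear forms, periodic functions of
linear forms, and indicators of open half-spaces bounded by linear hyperplanes. -/
def conicQuasiPoly (V : Type*) [AddCommGroup V] : Subalgebra ℝ (V → ℝ) :=
  Algebra.adjoin ℝ ({f | ∃ ℓ : V →+ ℤ, f = fun x => (ℓ x : ℝ)} ∪
    {f | ∃ (ℓ : V →+ ℤ) (g : ℤ → ℝ), IsPeriodicFn g ∧ f = fun x => g (ℓ x)} ∪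
    {f | ∃ ℓ : V →+ ℤ, f = fun x => if 0 < ℓ x then 1 else 0})

section Conic

variable {V W : Type*} [AddCommGroup V] [AddCommGroup W]

lemma linear_mem_conicQuasiPoly (ℓ : V →+ ℤ) : (fun x => (ℓ x : ℝ)) ∈ conicQuasiPoly V :=
  Algebra.subset_adjoin (Or.inl (Or.inl ⟨ℓ, rfl⟩))

lemma periodic_mem_conicQuasiPoly (ℓ : V →+ ℤ) {g : ℤ → ℝ} (hg : IsPeriodicFn g) :
    (fun x => g (ℓ x)) ∈ conicQuasiPoly V :=
  Algebra.subset_adjoin (Or.inl (Or.inr ⟨ℓ, g, hg, rfl⟩))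

lemma pos_mem_conicQuasiPoly (ℓ : V →+ ℤ) :
    (fun x => if 0 < ℓ x then (1 : ℝ) else 0) ∈ conicQuasiPoly V :=
  Algebra.subset_adjoin (Or.inr ⟨ℓ, rfl⟩)

lemma const_mem_conicQuasiPoly (c : ℝ) : (fun _ : V => c) ∈ conicQuasiPoly V :=
  Subalgebra.algebraMap_mem _ c

lemma lt_mem_conicQuasiPoly (ℓ m : V →+ ℤ) :
    (fun x => if ℓ x < m x then (1 : ℝ) else 0) ∈ conicQuasiPoly V := by
  have := pos_mem_conicQuasiPoly (m - ℓ)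
  simpa using this

lemma le_mem_conicQuasiPoly (ℓ m : V →+ ℤ) :
    (fun x => if ℓ x ≤ m x then (1 : ℝ) else 0) ∈ conicQuasiPoly V := by
  have : (fun x => if ℓ x ≤ m x then (1 : ℝ) else 0) =
      (fun _ => 1) - fun x => if m x < ℓ x then (1 : ℝ) else 0 := by
    funext x
    by_cases h : ℓ x ≤ m x
    · simp [h, not_lt.2 h]
    · simp [h, not_le.1 h]
  rw [this]
  exact sub_mem (const_mem_conicQuasiPoly 1) (lt_mem_conicQuasiPoly m ℓ)

lemma eq_mem_conicQuasiPoly (ℓ m : V →+ ℤ) :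
    (fun x => if ℓ x = m x then (1 : ℝ) else 0) ∈ conicQuasiPoly V := by
  have : (fun x => if ℓ x = m x then (1 : ℝ) else 0) =
      (fun x => if ℓ x ≤ m x then (1 : ℝ) else 0) * fun x => if m x ≤ ℓ x then (1 : ℝ) else 0 := by
    funext x
    simp only [Pi.mul_apply, ite_zero_mul_ite_zero, mul_one, le_antisymm_iff]
  rw [this]
  exact mul_mem (le_mem_conicQuasiPoly ℓ m) (le_mem_conicQuasiPoly m ℓ)

lemma comp_mem_conicQuasiPoly {f : W → ℝ} (hf : f ∈ conicQuasiPoly W) (L : V →+ W) :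
    (fun x => f (L x)) ∈ conicQuasiPoly V := by
  refine Algebra.adjoin_induction (p := fun f _ => (fun x => f (L x)) ∈ conicQuasiPoly V)
    ?_ ?_ ?_ ?_ hf
  · rintro _ ((⟨ℓ, rfl⟩ | ⟨ℓ, g, hg, rfl⟩) | ⟨ℓ, rfl⟩)
    · exact linear_mem_conicQuasiPoly (ℓ.comp L)
    · exact periodic_mem_conicQuasiPoly (ℓ.comp L) hg
    · exact pos_mem_conicQuasiPoly (ℓ.comp L)
  · exact fun c => const_mem_conicQuasiPoly c
  · exact fun _ _ _ _ h1 h2 => add_mem h1 h2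
  · exact fun _ _ _ _ h1 h2 => mul_mem h1 h2

lemma quasiPoly_ediv_mem_conicQuasiPoly {G : ℤ → ℝ} (hG : G ∈ quasiPoly) (ℓ : V →+ ℤ) (e : ℤ)
    {B : ℤ} (hB : 0 < B) : (fun x => G ((ℓ x - e) / B)) ∈ conicQuasiPoly V := by
  refine Algebra.adjoin_induction
    (p := fun G _ => (fun x => G ((ℓ x - e) / B)) ∈ conicQuasiPoly V) ?_ ?_ ?_ ?_ hG
  · rintro _ (rfl | hg)
    · have : (fun x => (((ℓ x - e) / B : ℤ) : ℝ)) = (B : ℝ)⁻¹ • ((fun x => (ℓ x : ℝ)) -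
          (fun _ => (e : ℝ)) - fun x => (((ℓ x - e) % B : ℤ) : ℝ)) := by
        funext x
        have h := Int.mul_ediv_add_emod (ℓ x - e) B
        have h' : (B : ℝ) * (((ℓ x - e) / B : ℤ) : ℝ) + (((ℓ x - e) % B : ℤ) : ℝ) = ℓ x - e := by
          exact_mod_cast h
        have hB' : (B : ℝ) ≠ 0 := by exact_mod_cast hB.ne'
        simp only [Pi.smul_apply, Pi.sub_apply, smul_eq_mul]
        rw [← h']
        field_simp
        ring
      rw [this]
      exact Subalgebra.smul_mem _ (sub_mem (sub_mem (linear_mem_conicQuasiPoly ℓ)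
        (const_mem_conicQuasiPoly _))
        (periodic_mem_conicQuasiPoly ℓ (IsPeriodicFn.emod hB e))) _
    · exact periodic_mem_conicQuasiPoly ℓ (IsPeriodicFn.comp_ediv hg e hB)
  · exact fun c => const_mem_conicQuasiPoly c
  · exact fun _ _ _ _ h1 h2 => add_mem h1 h2
  · exact fun _ _ _ _ h1 h2 => mul_mem h1 h2

lemma quasiPoly_comp_mem_conicQuasiPoly {G : ℤ → ℝ} (hG : G ∈ quasiPoly) (ℓ : V →+ ℤ) :
    (fun x => G (ℓ x)) ∈ conicQuasiPoly V := by
  simpa using quasiPoly_ediv_mem_conicQuasiPoly hG ℓ 0 one_pos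

lemma lt_bit_mem_conicQuasiPoly (r : V →+ ℤ) {e : ℤ} (he : e = 0 ∨ e = 1) :
    (fun x => if r x < e then (1 : ℝ) else 0) ∈ conicQuasiPoly V := by
  rcases he with rfl | rfl
  · simpa using lt_mem_conicQuasiPoly r 0
  · simpa [Int.lt_iff_add_one_le] using le_mem_conicQuasiPoly r 0

/-- A function of `(x, y)` that depends on `y` through a monomial, a periodic factor and a single
threshold. -/
def thresholdFn (a : V → ℝ) (k : ℕ) (g : ℤ → ℝ) (r : V →+ ℤ) (B e : ℤ) : V × ℤ → ℝ :=
  fun z => a z.1 * ((z.2 : ℝ) ^ k * g z.2) * if r z.1 < B * z.2 + e then 1 else 0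

/-- The span of the functions `thresholdFn a k g r B e` with `a` in `conicQuasiPoly V`. -/
def thresholdSpan (V : Type*) [AddCommGroup V] : Submodule ℝ (V × ℤ → ℝ) :=
  Submodule.span ℝ {f | ∃ a k g, ∃ r : V →+ ℤ, ∃ B e : ℤ, a ∈ conicQuasiPoly V ∧ IsPeriodicFn g ∧
    0 < B ∧ (e = 0 ∨ e = 1) ∧ f = thresholdFn a k g r B e}

lemma thresholdFn_mem {a : V → ℝ} (ha : a ∈ conicQuasiPoly V) (k : ℕ) {g : ℤ → ℝ}
    (hg : IsPeriodicFn g) (r : V →+ ℤ) {B e : ℤ} (hB : 0 < B) (he : e = 0 ∨ e = 1) :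
    thresholdFn a k g r B e ∈ thresholdSpan V :=
  Submodule.subset_span ⟨a, k, g, r, B, e, ha, hg, hB, he, rfl⟩

lemma thresholdFn_mul_threshold_mem {a : V → ℝ} (ha : a ∈ conicQuasiPoly V) (k : ℕ) {g : ℤ → ℝ}
    (hg : IsPeriodicFn g) (r : V →+ ℤ) {B e : ℤ} (hB : 0 < B) (he : e = 0 ∨ e = 1)
    (r' : V →+ ℤ) {B' e' : ℤ} (hB' : 0 < B') (he' : e' = 0 ∨ e' = 1) :
    (thresholdFn a k g r B e * fun z => if r' z.1 < B' * z.2 + e' then 1 else 0) ∈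
      thresholdSpan V := by
  have key : (thresholdFn a k g r B e * fun z => if r' z.1 < B' * z.2 + e' then 1 else 0) =
      thresholdFn (a * fun x => if (B • r') x < (B' • r) x then 1 else 0) k g r B e +
      thresholdFn (a * fun x => if (B' • r) x < (B • r') x then 1 else 0) k g r' B' e' +
      thresholdFn (a * fun x => if (B' • r) x = (B • r') x then 1 else 0) k g r B (min e e') := by
    funext ⟨x, y⟩
    simp only [thresholdFn, Pi.mul_apply, Pi.add_apply, AddMonoidHom.smul_apply, smul_eq_mul]
    have h1 : r x < B * y → B' * r x < B' * (B * y) := fun h => mul_lt_mul_of_pos_left h hB'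
    have h2 : r x ≤ B * y → B' * r x ≤ B' * (B * y) := fun h => mul_le_mul_of_nonneg_left h hB'.le
    have h3 : B * y < r x → B' * (B * y) < B' * r x := fun h => mul_lt_mul_of_pos_left h hB'
    have h4 : B * y ≤ r x → B' * (B * y) ≤ B' * r x := fun h => mul_le_mul_of_nonneg_left h hB'.le
    have h1' : r' x < B' * y → B * r' x < B * (B' * y) := fun h => mul_lt_mul_of_pos_left h hB
    have h2' : r' x ≤ B' * y → B * r' x ≤ B * (B' * y) :=
      fun h => mul_le_mul_of_nonneg_left h hB.le
    have h3' : B' * y < r' x → B * (B' * y) < B * r' x := fun h => mul_lt_mul_of_pos_left h hB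
    have h4' : B' * y ≤ r' x → B * (B' * y) ≤ B * r' x :=
      fun h => mul_le_mul_of_nonneg_left h hB.le
    have h5 : B * (B' * y) = B' * (B * y) := by ring
    rw [h5] at h1' h2' h3' h4'
    rcases lt_trichotomy (B' * r x) (B * r' x) with h | h | h
    · have : (r x < B * y + e ∧ r' x < B' * y + e') ↔ r' x < B' * y + e' := by omega
      simp only [h, not_lt.2 h.le, h.ne, if_true, if_false, mul_zero, zero_mul, mul_one, zero_add,
        add_zero, mul_assoc, ite_zero_mul_ite_zero, this]
    · have : (r x < B * y + e ∧ r' x < B' * y + e') ↔ r x < B * y + min e e' := by omega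
      simp only [h, lt_irrefl, if_true, if_false, mul_zero, zero_mul, mul_one, zero_add,
        add_zero, mul_assoc, ite_zero_mul_ite_zero, this]
    · have : (r x < B * y + e ∧ r' x < B' * y + e') ↔ r x < B * y + e := by omega
      simp only [h, not_lt.2 h.le, h.ne', if_true, if_false, mul_zero, zero_mul, mul_one, add_zero,
        mul_assoc, ite_zero_mul_ite_zero, this]
  rw [key]
  refine add_mem (add_mem ?_ ?_) ?_
  · exact thresholdFn_mem (mul_mem ha (lt_mem_conicQuasiPoly _ _)) k hg r hB he
  · exact thresholdFn_mem (mul_mem ha (lt_mem_conicQuasiPoly _ _)) k hg r' hB' he'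
  · exact thresholdFn_mem (mul_mem ha (eq_mem_conicQuasiPoly _ _)) k hg r hB (by omega)

lemma thresholdFn_mul_mem {a : V → ℝ} (ha : a ∈ conicQuasiPoly V) (k : ℕ) {g : ℤ → ℝ}
    (hg : IsPeriodicFn g) (r : V →+ ℤ) {B e : ℤ} (hB : 0 < B) (he : e = 0 ∨ e = 1)
    {f : V × ℤ → ℝ} (hf : f ∈ ({f | ∃ ℓ : V × ℤ →+ ℤ, f = fun x => (ℓ x : ℝ)} ∪
    {f | ∃ (ℓ : V × ℤ →+ ℤ) (g : ℤ → ℝ), IsPeriodicFn g ∧ f = fun x => g (ℓ x)} ∪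
    {f | ∃ ℓ : V × ℤ →+ ℤ, f = fun x => if 0 < ℓ x then 1 else 0} : Set (V × ℤ → ℝ))) :
    thresholdFn a k g r B e * f ∈ thresholdSpan V := by
  have split : ∀ ℓ : V × ℤ →+ ℤ, ∃ (m : V →+ ℤ) (b : ℤ), ∀ x y, ℓ (x, y) = m x + b * y := by
    intro ℓ
    refine ⟨ℓ.comp (AddMonoidHom.inl V ℤ), ℓ (0, 1), fun x y => ?_⟩
    have : (x, y) = (x, 0) + y • ((0, 1) : V × ℤ) := by simp
    rw [this, map_add, map_zsmul]
    simp [mul_comm]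
  rcases hf with (⟨ℓ, rfl⟩ | ⟨ℓ, φ, hφ, rfl⟩) | ⟨ℓ, rfl⟩
  · obtain ⟨m, b, h⟩ := split ℓ
    have key : (thresholdFn a k g r B e * fun z => (ℓ z : ℝ)) =
        thresholdFn (a * fun x => (m x : ℝ)) k g r B e +
        (b : ℝ) • thresholdFn a (k + 1) g r B e := by
      funext ⟨x, y⟩
      simp only [thresholdFn, Pi.mul_apply, Pi.add_apply, Pi.smul_apply, smul_eq_mul, h]
      push_cast
      ring
    rw [key]
    exact add_mem (thresholdFn_mem (mul_mem ha (linear_mem_conicQuasiPoly m)) k hg r hB he)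
      (Submodule.smul_mem _ _ (thresholdFn_mem ha _ hg r hB he))
  · obtain ⟨m, b, h⟩ := split ℓ
    obtain ⟨N, hN, hφ'⟩ := id hφ
    have hNZ : (0 : ℤ) < N := by exact_mod_cast hN
    have key : (thresholdFn a k g r B e * fun z => φ (ℓ z)) = ∑ c ∈ range N,
        thresholdFn (a * fun x => (fun t : ℤ => if t % N = c then (1 : ℝ) else 0) (m x)) k
          (fun y => g y * φ (c + b * y)) r B e := by
      funext ⟨x, y⟩
      simp only [thresholdFn, Pi.mul_apply, Finset.sum_apply, h]
      have hr := Int.emod_nonneg (m x) hNZ.ne'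
      have hr' := Int.emod_lt_of_pos (m x) hNZ
      rw [Finset.sum_eq_single (m x % N).toNat]
      · have h1 : (((m x % N).toNat : ℕ) : ℤ) = m x % N := Int.toNat_of_nonneg hr
        have h2 : φ (m x % N + b * y) = φ (m x + b * y) := by
          rw [← hφ'.int_mul (m x / N) (m x % N + b * y)]
          congr 1
          have := Int.mul_ediv_add_emod (m x) N
          simp only [Int.cast_id]
          linarith
        rw [h1, if_pos rfl, h2]
        ring
      · intro c _ hc
        rw [if_neg (by omega)]
        ring
      · intro hc
        exact absurd (mem_range.2 (by omega)) hc
    rw [key]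
    refine sum_mem fun c _ => thresholdFn_mem (mul_mem ha (periodic_mem_conicQuasiPoly m
      (g := fun t : ℤ => if t % N = c then (1 : ℝ) else 0) ?_)) k
      (hg.mul (hφ.comp_affine b c)) r hB he
    refine ⟨N, hN, fun t => ?_⟩
    simp
  · obtain ⟨m, b, h⟩ := split ℓ
    rcases lt_trichotomy b 0 with hb | rfl | hb
    · have key : (thresholdFn a k g r B e * fun z => if 0 < ℓ z then (1 : ℝ) else 0) =
          thresholdFn a k g r B e -
          (thresholdFn a k g r B e * fun z => if m z.1 < -b * z.2 + 1 then 1 else 0) := by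
        funext ⟨x, y⟩
        simp only [Pi.mul_apply, Pi.sub_apply, h]
        by_cases h' : 0 < m x + b * y
        · rw [if_pos h', if_neg (by simp only [neg_mul]; omega)]
          ring
        · rw [if_neg h', if_pos (by simp only [neg_mul]; omega)]
          ring
      rw [key]
      exact sub_mem (thresholdFn_mem ha k hg r hB he) (thresholdFn_mul_threshold_mem ha k hg r hB he
        m (by omega) (Or.inr rfl))
    · have key : (thresholdFn a k g r B e * fun z => if 0 < ℓ z then (1 : ℝ) else 0) =
          thresholdFn (a * fun x => if 0 < m x then 1 else 0) k g r B e := by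
        funext ⟨x, y⟩
        simp only [thresholdFn, Pi.mul_apply, h, zero_mul, add_zero]
        ring
      rw [key]
      exact thresholdFn_mem (mul_mem ha (pos_mem_conicQuasiPoly m)) k hg r hB he
    · have key : (fun z => if 0 < ℓ z then (1 : ℝ) else 0) =
          fun z => if (-m) z.1 < b * z.2 + 0 then 1 else 0 := by
        funext ⟨x, y⟩
        simp only [h, AddMonoidHom.neg_apply, add_zero, neg_lt_iff_pos_add']
      rw [key]
      exact thresholdFn_mul_threshold_mem ha k hg r hB he _ hb (Or.inl rfl)

lemma mul_mem_thresholdSpan {f : V × ℤ → ℝ} (hf : f ∈ conicQuasiPoly (V × ℤ)) :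
    ∀ t ∈ thresholdSpan V, t * f ∈ thresholdSpan V := by
  refine Algebra.adjoin_induction
    (p := fun f _ => ∀ t ∈ thresholdSpan V, t * f ∈ thresholdSpan V) ?_ ?_ ?_ ?_ hf
  · intro f hf t ht
    refine Submodule.span_induction (p := fun t _ => t * f ∈ thresholdSpan V) ?_ ?_ ?_ ?_ ht
    · rintro _ ⟨a, k, g, r, B, e, ha, hg, hB, he, rfl⟩
      exact thresholdFn_mul_mem ha k hg r hB he hf
    · simp
    · intro _ _ _ _ h1 h2
      rw [add_mul]
      exact add_mem h1 h2
    · intro c _ _ h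
      rw [smul_mul_assoc]
      exact Submodule.smul_mem _ _ h
  · intro c t ht
    rw [mul_comm, ← Algebra.smul_def]
    exact Submodule.smul_mem _ _ ht
  · intro _ _ _ _ h1 h2 t ht
    rw [mul_add]
    exact add_mem (h1 t ht) (h2 t ht)
  · intro _ _ _ _ h1 h2 t ht
    rw [← mul_assoc]
    exact h2 _ (h1 t ht)

lemma sum_thresholdFn_mem {a : V → ℝ} (ha : a ∈ conicQuasiPoly V) (k : ℕ) {g : ℤ → ℝ}
    (hg : IsPeriodicFn g) (r : V →+ ℤ) {B e : ℤ} (hB : 0 < B) (he : e = 0 ∨ e = 1)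
    (Q : V →+ ℤ) :
    (fun x => ∑ y ∈ Icc 0 (Q x), thresholdFn a k g r B e (x, y)) ∈ conicQuasiPoly V := by
  obtain ⟨G, hG, hdiff⟩ := exists_backwardDiff k g hg
  have key : (fun x => ∑ y ∈ Icc 0 (Q x), thresholdFn a k g r B e (x, y)) =
      a * ((fun x => if (0 : V →+ ℤ) x ≤ Q x then (1 : ℝ) else 0) *
        (fun x => if r x < e then (1 : ℝ) else 0) * ((fun x => G (Q x)) - fun _ => G (-1)) +
        ((fun _ => 1) - (fun x => if r x < e then (1 : ℝ) else 0)) *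
        (fun x => if r x ≤ (B • Q) x then (1 : ℝ) else 0) *
          ((fun x => G (Q x)) - fun x => G ((r x - e) / B))) := by
    funext x
    simp only [thresholdFn, Pi.mul_apply, Pi.add_apply, Pi.sub_apply, AddMonoidHom.smul_apply,
      AddMonoidHom.zero_apply, smul_eq_mul, mul_assoc, ← mul_sum]
    congr 1
    have hfloor : ∀ y, r x < B * y + e ↔ (r x - e) / B < y := by
      intro y
      rw [Int.ediv_lt_iff_lt_mul hB, mul_comm y B]
      omega
    simp only [← mul_assoc, mul_ite, mul_one, mul_zero, ← sum_filter]
    by_cases hr : r x < e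
    · have hu : (r x - e) / B < 0 := by
        rw [Int.ediv_lt_iff_lt_mul hB]
        omega
      simp only [hr, if_true, sub_self, ite_self, zero_mul, add_zero]
      have : (Icc 0 (Q x)).filter (fun y => r x < B * y + e) = Ioc (-1) (Q x) := by
        ext y
        simp only [mem_filter, mem_Icc, mem_Ioc, hfloor]
        omega
      rw [this]
      by_cases hQ : 0 ≤ Q x
      · rw [sum_Ioc_of_backwardDiff hdiff (by omega), if_pos hQ]
        ring
      · rw [if_neg hQ, Ioc_eq_empty (by omega)]
        simp
    · have hu : 0 ≤ (r x - e) / B := Int.ediv_nonneg (by omega) hB.le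
      simp only [hr, if_false]
      have : (Icc 0 (Q x)).filter (fun y => r x < B * y + e) = Ioc ((r x - e) / B) (Q x) := by
        ext y
        simp only [mem_filter, mem_Icc, mem_Ioc, hfloor]
        omega
      rw [this]
      by_cases hQ : r x ≤ B * Q x
      · have h1 : (r x - e) / B ≤ Q x := by
          rw [← Int.lt_add_one_iff, Int.ediv_lt_iff_lt_mul hB]
          have : (Q x + 1) * B = B * Q x + B := by ring
          omega
        rw [sum_Ioc_of_backwardDiff hdiff h1, if_pos hQ]
        ring
      · have h1 : Q x ≤ (r x - e) / B := by
          rw [Int.le_ediv_iff_mul_le hB]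
          have : Q x * B = B * Q x := by ring
          omega
        rw [if_neg hQ, Ioc_eq_empty (by omega)]
        simp
  rw [key]
  have h1 := lt_bit_mem_conicQuasiPoly r he
  have h2 := quasiPoly_comp_mem_conicQuasiPoly hG Q
  exact mul_mem ha (add_mem (mul_mem (mul_mem (le_mem_conicQuasiPoly 0 Q) h1)
    (sub_mem h2 (const_mem_conicQuasiPoly _)))
    (mul_mem (mul_mem (sub_mem (const_mem_conicQuasiPoly 1) h1) (le_mem_conicQuasiPoly r (B • Q)))
    (sub_mem h2 (quasiPoly_ediv_mem_conicQuasiPoly hG r e hB))))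

lemma sum_Icc_mem_conicQuasiPoly {f : V × ℤ → ℝ} (hf : f ∈ conicQuasiPoly (V × ℤ))
    (Q : V →+ ℤ) : (fun x => ∑ y ∈ Icc 0 (Q x), f (x, y)) ∈ conicQuasiPoly V := by
  have h1 : thresholdFn (fun _ : V => 1) 0 (fun _ => 1) 0 1 1 * f ∈ thresholdSpan V :=
    mul_mem_thresholdSpan hf _ (thresholdFn_mem (const_mem_conicQuasiPoly 1) 0
      (IsPeriodicFn.const 1) 0 one_pos (Or.inr rfl))
  have h2 : (fun x => ∑ y ∈ Icc 0 (Q x), f (x, y)) = fun x => ∑ y ∈ Icc 0 (Q x),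
      (thresholdFn (fun _ : V => 1) 0 (fun _ => 1) 0 1 1 * f) (x, y) := by
    funext x
    refine sum_congr rfl fun y hy => ?_
    have := (mem_Icc.1 hy).1
    simp [thresholdFn, this]
  rw [h2]
  refine Submodule.span_induction
    (p := fun t _ => (fun x => ∑ y ∈ Icc 0 (Q x), t (x, y)) ∈ conicQuasiPoly V) ?_ ?_ ?_ ?_ h1
  · rintro _ ⟨a, k, g, r, B, e, ha, hg, hB, he, rfl⟩
    exact sum_thresholdFn_mem ha k hg r hB he Q
  · simpa using const_mem_conicQuasiPoly (0 : ℝ)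
  · intro s t _ _ h1 h2
    simp only [Pi.add_apply, sum_add_distrib]
    exact add_mem h1 h2
  · intro c t _ h
    simp only [Pi.smul_apply, ← smul_sum]
    exact Subalgebra.smul_mem _ h c

lemma sum_pi_fin_mem_conicQuasiPoly (d : ℕ) : ∀ {V : Type} [AddCommGroup V]
    {f : V × (Fin d → ℤ) → ℝ}, f ∈ conicQuasiPoly (V × (Fin d → ℤ)) → ∀ Q : V →+ ℤ,
    (fun x => ∑ y ∈ Fintype.piFinset fun _ : Fin d => Icc 0 (Q x), f (x, y)) ∈
      conicQuasiPoly V := by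
  induction d with
  | zero =>
    intro V _ f hf Q
    have := comp_mem_conicQuasiPoly hf (AddMonoidHom.inl V (Fin 0 → ℤ))
    convert this using 2 with x
    simp only [AddMonoidHom.inl_apply]
    have h : (Fintype.piFinset fun _ : Fin 0 => Icc 0 (Q x)) = {0} := by
      ext y
      simp only [Fintype.mem_piFinset, mem_singleton]
      exact ⟨fun _ => Subsingleton.elim _ _, fun _ i => i.elim0⟩
    rw [h, sum_singleton]
  | succ d ih =>
    intro V _ f hf Q
    let L : (V × ℤ) × (Fin d → ℤ) →+ V × (Fin (d + 1) → ℤ) :=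
      { toFun := fun z => (z.1.1, Fin.cons z.1.2 z.2)
        map_zero' := by
          ext i
          · rfl
          · refine Fin.cases ?_ (fun _ => ?_) i <;> simp
        map_add' := by
          intro a b
          ext i
          · rfl
          · refine Fin.cases ?_ (fun _ => ?_) i <;> simp }
    have h1 := ih (comp_mem_conicQuasiPoly hf L) (Q.comp (AddMonoidHom.fst V ℤ))
    have h2 := sum_Icc_mem_conicQuasiPoly h1 Q
    convert h2 using 2 with x
    simp only [AddMonoidHom.comp_apply, AddMonoidHom.coe_fst, L, AddMonoidHom.coe_mk,
      ZeroHom.coe_mk]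
    rw [← sum_product']
    refine (sum_bij (fun z _ => Fin.cons z.1 z.2) ?_ ?_ ?_ ?_).symm
    · intro z hz
      rw [mem_product, Fintype.mem_piFinset] at hz
      rw [Fintype.mem_piFinset]
      exact fun i => Fin.cases (by simpa using hz.1) (fun j => by simpa using hz.2 j) i
    · intro a _ b _ h
      obtain ⟨h1, h2⟩ := Fin.cons_inj.1 h
      exact Prod.ext h1 h2
    · intro y hy
      rw [Fintype.mem_piFinset] at hy
      refine ⟨(y 0, Fin.tail y), ?_, Fin.cons_self_tail y⟩
      rw [mem_product, Fintype.mem_piFinset]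
      exact ⟨hy 0, fun j => hy j.succ⟩
    · intro _ _
      rfl

lemma sum_pi_mem_conicQuasiPoly {ι V : Type} [Fintype ι] [DecidableEq ι] [AddCommGroup V]
    {f : V × (ι → ℤ) → ℝ} (hf : f ∈ conicQuasiPoly (V × (ι → ℤ))) (Q : V →+ ℤ) :
    (fun x => ∑ y ∈ Fintype.piFinset fun _ : ι => Icc 0 (Q x), f (x, y)) ∈ conicQuasiPoly V := by
  let σ := Fintype.equivFin ι
  let L : V × (Fin (Fintype.card ι) → ℤ) →+ V × (ι → ℤ) :=
    { toFun := fun z => (z.1, z.2 ∘ σ)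
      map_zero' := rfl
      map_add' := fun _ _ => rfl }
  have h := sum_pi_fin_mem_conicQuasiPoly _ (comp_mem_conicQuasiPoly hf L) Q
  convert h using 2 with x
  refine sum_bij (fun y _ => y ∘ σ.symm) ?_ ?_ ?_ ?_
  · intro y hy
    rw [Fintype.mem_piFinset] at hy ⊢
    exact fun i => hy _
  · intro a _ b _ h
    exact σ.symm.surjective.injective_comp_right h
  · intro y hy
    rw [Fintype.mem_piFinset] at hy
    exact ⟨y ∘ σ, Fintype.mem_piFinset.2 fun i => hy _, by ext; simp⟩
  · intro y _
    simp only [L, AddMonoidHom.coe_mk, ZeroHom.coe_mk]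
    congr 2
    ext
    simp

end Conic

/-- `f` is given by the polynomial `c (n % N)` at `n`. -/
def IsConstituents (f : ℕ → ℝ) (N : ℕ) (c : ℕ → Polynomial ℝ) : Prop :=
  0 < N ∧ ∀ n : ℕ, f n = (c (n % N)).eval (n : ℝ)

lemma exists_isConstituents_of_mem_conicQuasiPoly {f : ℤ → ℝ} (hf : f ∈ conicQuasiPoly ℤ)
    {i : ℕ} (hi : 1 ≤ i) (p : ℕ) :
    ∃ N c, IsConstituents (fun n => f ((i + n * p : ℕ) : ℤ)) N c := by
  refine Algebra.adjoin_induction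
    (p := fun f _ => ∃ N c, IsConstituents (fun n => f ((i + n * p : ℕ) : ℤ)) N c) ?_ ?_ ?_ ?_ hf
  · have hℓ : ∀ (ℓ : ℤ →+ ℤ) (t : ℤ), ℓ t = t * ℓ 1 := fun ℓ t => by
      have := map_zsmul ℓ t 1
      simpa using this
    rintro _ ((⟨ℓ, rfl⟩ | ⟨ℓ, g, ⟨N, hN, hg⟩, rfl⟩) | ⟨ℓ, rfl⟩)
    · refine ⟨1, fun _ => (Polynomial.C (i : ℝ) + Polynomial.X * Polynomial.C (p : ℝ)) *
        Polynomial.C (ℓ 1 : ℝ), one_pos, fun n => ?_⟩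
      simp only
      rw [hℓ]
      simp
    · refine ⟨N, fun k => Polynomial.C (g (ℓ ((i + k * p : ℕ) : ℤ))), hN, fun n => ?_⟩
      simp only
      rw [Polynomial.eval_C, hℓ, hℓ ℓ ((i + n % N * p : ℕ) : ℤ)]
      have h := hg.int_mul ((n / N : ℕ) * p * ℓ 1) (((i + n % N * p : ℕ) : ℤ) * ℓ 1)
      rw [← h]
      congr 1
      have h2 : (n : ℤ) = N * (n / N : ℕ) + (n % N : ℕ) := by
        exact_mod_cast (Nat.div_add_mod n N).symm
      simp only [Int.cast_id, Nat.cast_add, Nat.cast_mul]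
      linear_combination (p : ℤ) * ℓ 1 * h2
    · refine ⟨1, fun _ => Polynomial.C (if 0 < ℓ 1 then 1 else 0), one_pos, fun n => ?_⟩
      have h : (0 : ℤ) < ((i + n * p : ℕ) : ℤ) := by exact_mod_cast (by omega : 0 < i + n * p)
      simp only
      rw [Polynomial.eval_C, hℓ]
      simp only [mul_pos_iff_of_pos_left h]
  · exact fun r => ⟨1, fun _ => Polynomial.C r, one_pos, fun n => by simp⟩
  · rintro f g _ _ ⟨M, a, hM, ha⟩ ⟨N, b, hN, hb⟩
    refine ⟨M * N, fun k => a (k % M) + b (k % N), Nat.mul_pos hM hN, fun n => ?_⟩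
    simp only at ha hb
    simp only [Pi.add_apply, ha, hb, Polynomial.eval_add, Nat.mod_mul_right_mod,
      Nat.mod_mul_left_mod]
  · rintro f g _ _ ⟨M, a, hM, ha⟩ ⟨N, b, hN, hb⟩
    refine ⟨M * N, fun k => a (k % M) * b (k % N), Nat.mul_pos hM hN, fun n => ?_⟩
    simp only at ha hb
    simp only [Pi.mul_apply, ha, hb, Polynomial.eval_mul, Nat.mod_mul_right_mod,
      Nat.mod_mul_left_mod]

open Filter Topology

lemma Polynomial.degree_le_and_coeff_eq_of_tendsto {P : Polynomial ℝ} {d : ℕ} {L : ℝ} {x : ℕ → ℝ}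
    (hx : Tendsto x atTop atTop) (h : Tendsto (fun j => P.eval (x j) / x j ^ d) atTop (𝓝 L)) :
    P.degree ≤ d ∧ P.coeff d = L := by
  have hX : ((X : Polynomial ℝ) ^ d).degree = d := degree_X_pow d
  have hev : ∀ y : ℝ, P.eval y / y ^ d = P.eval y / ((X : Polynomial ℝ) ^ d).eval y := by simp
  simp only [hev] at h
  rcases lt_trichotomy P.degree d with hd | hd | hd
  · refine ⟨hd.le, ?_⟩
    rw [coeff_eq_zero_of_degree_lt hd]
    exact tendsto_nhds_unique
      ((div_tendsto_atTop_zero_of_degree_lt P (X ^ d) (by rwa [hX])).comp hx) h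
  · refine ⟨hd.le, ?_⟩
    have := tendsto_nhds_unique
      ((div_tendsto_atTop_leadingCoeff_div_of_degree_eq P (X ^ d) (by rwa [hX])).comp hx) h
    rw [← this, leadingCoeff_X_pow, div_one, leadingCoeff, natDegree_eq_of_degree_eq_some hd]
  · exfalso
    have h1 := (abs_div_tendsto_atTop_atTop_of_degree_gt P (X ^ d) (by rwa [hX])
      (pow_ne_zero _ X_ne_zero)).comp hx
    exact not_tendsto_nhds_of_tendsto_atTop h1 _ h.abs

lemma IsConstituents.degree_le_and_coeff_eq {f : ℕ → ℝ} {N : ℕ} {c : ℕ → Polynomial ℝ}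
    (h : IsConstituents f N c) {d : ℕ} {L : ℝ}
    (hL : Tendsto (fun n => f n / (n : ℝ) ^ d) atTop (𝓝 L)) {k : ℕ} (hk : k < N) :
    (c k).degree ≤ d ∧ (c k).coeff d = L := by
  have hs : Tendsto (fun j => k + N * j) atTop atTop :=
    tendsto_atTop_mono (fun j => (Nat.le_mul_of_pos_left j h.1).trans (Nat.le_add_left _ _))
      tendsto_id
  refine Polynomial.degree_le_and_coeff_eq_of_tendsto (x := fun j => ((k + N * j : ℕ) : ℝ))
    (tendsto_natCast_atTop_atTop.comp hs) ?_
  refine (hL.comp hs).congr fun j => ?_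
  simp only [Function.comp_apply]
  rw [h.2, Nat.add_mul_mod_self_left, Nat.mod_eq_of_lt hk]

/-- The Apéry (Kunz) tuples modulo `p`: the least elements in each residue class of the numerical
semigroups containing `p`. -/
structure IsKunz (p : ℕ) (W : ZMod p → ℤ) : Prop where
  cast_eq : ∀ s, (W s : ZMod p) = s
  zero : W 0 = 0
  nonneg : ∀ s, 0 ≤ W s
  add_le : ∀ a b, W (a + b) ≤ W a + W b

lemma ZMod.exists_eq_add_mul_of_intCast_eq {p : ℕ} {a b : ℤ} (h : (a : ZMod p) = b) :
    ∃ k : ℤ, a = b + p * k := by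
  obtain ⟨k, hk⟩ := (ZMod.intCast_eq_intCast_iff_dvd_sub b a p).1 h.symm
  exact ⟨k, by linarith⟩

lemma ZMod.le_of_intCast_eq_of_lt_add {p : ℕ} {a b : ℤ} (h : (a : ZMod p) = b) (hab : a < b + p) :
    a ≤ b := by
  obtain ⟨k, rfl⟩ := ZMod.exists_eq_add_mul_of_intCast_eq h
  have hp : (0 : ℤ) ≤ p := Int.natCast_nonneg p
  have hk : k < 1 := by
    by_contra! hk
    nlinarith
  nlinarith

/-- The semigroup with Apéry tuple `W`. -/
def aperySemigroup (p : ℕ) (W : ZMod p → ℤ) : Set ℕ := {n | W n ≤ n}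

namespace IsKunz

variable {p : ℕ} {W : ZMod p → ℤ}

lemma exists_natCast (hW : IsKunz p W) (s : ZMod p) :
    ∃ n : ℕ, (n : ℤ) = W s ∧ (n : ZMod p) = s := by
  refine ⟨(W s).toNat, Int.toNat_of_nonneg (hW.nonneg s), ?_⟩
  rw [← Int.cast_natCast, Int.toNat_of_nonneg (hW.nonneg s), hW.cast_eq]

lemma mem_of_lt_add (hW : IsKunz p W) {n : ℕ} (h : W n < n + p) : n ∈ aperySemigroup p W :=
  ZMod.le_of_intCast_eq_of_lt_add (by rw [hW.cast_eq, Int.cast_natCast]) h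

lemma isNumericalSemigroup [NeZero p] (hW : IsKunz p W) :
    IsNumericalSemigroup (aperySemigroup p W) := by
  refine ⟨by simp [aperySemigroup, hW.zero], fun a ha b hb => ?_, ?_⟩
  · have := hW.add_le a b
    simp only [aperySemigroup, Set.mem_ofPred_eq, Nat.cast_add] at ha hb ⊢
    linarith
  · refine (Set.finite_iUnion fun s : ZMod p => Set.finite_Iio (W s).toNat).subset fun n hn => ?_
    simp only [aperySemigroup, Set.mem_compl_iff, Set.mem_ofPred_eq, not_le] at hn
    exact Set.mem_iUnion.2 ⟨n, Set.mem_Iio.2 (by omega)⟩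

lemma modulus_mem (hW : IsKunz p W) : p ∈ aperySemigroup p W := by
  simp [aperySemigroup, hW.zero]

lemma le_of_subset {W' : ZMod p → ℤ} (hW : IsKunz p W)
    (h : aperySemigroup p W ⊆ aperySemigroup p W') (s : ZMod p) : W' s ≤ W s := by
  obtain ⟨n, h1, h2⟩ := hW.exists_natCast s
  have : n ∈ aperySemigroup p W := by simp [aperySemigroup, h1, h2]
  have := h this
  simpa [aperySemigroup, h1, h2] using this

end IsKunz

lemma aperySemigroup_injOn (p : ℕ) : Set.InjOn (aperySemigroup p) {W | IsKunz p W} :=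
  fun _ hW _ hW' h =>
    funext fun s => le_antisymm (hW'.le_of_subset h.superset s) (hW.le_of_subset h.subset s)

lemma IsNumericalSemigroup.exists_aperySemigroup_eq {p : ℕ} [NeZero p] {H : Set ℕ}
    (hH : IsNumericalSemigroup H) (hp : p ∈ H) : ∃ W, IsKunz p W ∧ aperySemigroup p W = H := by
  obtain ⟨h0, hadd, hfin⟩ := hH
  have hp0 : 0 < p := Nat.pos_of_ne_zero (NeZero.ne p)
  have hmul : ∀ k : ℕ, ∀ a ∈ H, a + k * p ∈ H := by
    intro k a ha
    induction k with
    | zero => simpa using ha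
    | succ k ih =>
      have := hadd _ ih _ hp
      rwa [add_assoc, ← Nat.succ_mul] at this
  let S : ZMod p → Set ℕ := fun s => {n | n ∈ H ∧ (n : ZMod p) = s}
  have hne : ∀ s, (S s).Nonempty := by
    intro s
    obtain ⟨b, hb⟩ := hfin.bddAbove
    refine ⟨s.val + (b + 1) * p, ?_, by simp⟩
    by_contra hn
    have h1 := hb hn
    have h2 : b + 1 ≤ (b + 1) * p := Nat.le_mul_of_pos_right _ hp0
    omega
  have hmem : ∀ s, sInf (S s) ∈ S s := fun s => Nat.sInf_mem (hne s)
  have hle : ∀ s, ∀ n ∈ H, (n : ZMod p) = s → sInf (S s) ≤ n := fun s n h1 h2 =>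
    Nat.sInf_le ⟨h1, h2⟩
  refine ⟨fun s => (sInf (S s) : ℕ), ⟨fun s => ?_, ?_, fun s => Int.natCast_nonneg _,
    fun a b => ?_⟩, ?_⟩
  · rw [Int.cast_natCast]
    exact (hmem s).2
  · have := hle 0 0 h0 Nat.cast_zero
    simpa using this
  · have := hle (a + b) _ (hadd _ (hmem a).1 _ (hmem b).1) (by
      rw [Nat.cast_add, (hmem a).2, (hmem b).2])
    exact_mod_cast this
  · ext n
    simp only [aperySemigroup, Set.mem_ofPred_eq, Nat.cast_le]
    refine ⟨fun h => ?_, fun h => hle _ n h rfl⟩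
    have h1 : p ∣ n - sInf (S n) := by
      rw [← Nat.modEq_iff_dvd' h, ← ZMod.natCast_eq_natCast_iff]
      exact (hmem n).2
    obtain ⟨k, hk⟩ := h1
    have h2 := hmul k _ (hmem n).1
    rwa [mul_comm k p, ← hk, Nat.add_sub_cancel' h] at h2

/-- `K` is the conductor of `H`, i.e. `K - 1` is its Frobenius number. -/
def IsConductor (H : Set ℕ) (K : ℕ) : Prop := (∀ n, K ≤ n → n ∈ H) ∧ ∀ n, n + 1 = K → n ∉ H

lemma exists_isConductor {H : Set ℕ} (h : Hᶜ.Finite) : ∃ K, IsConductor H K := by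
  obtain ⟨b, hb⟩ := h.bddAbove
  have hex : ∃ K, ∀ n, K ≤ n → n ∈ H := ⟨b + 1, fun n hn => by
    by_contra hc
    have := hb hc
    omega⟩
  classical
  refine ⟨Nat.find hex, Nat.find_spec hex, fun n hn hmem => ?_⟩
  refine Nat.find_min hex (m := n) (by omega) fun m hm => ?_
  rcases hm.eq_or_lt with rfl | hm
  · exact hmem
  · exact Nat.find_spec hex m (by omega)

lemma IsConductor.frobNum_eq {H : Set ℕ} {K : ℕ} (hK : IsConductor H K) :
    frobNum H = (K : ℤ) - 1 := by
  refine IsGreatest.csSup_eq ⟨?_, ?_⟩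
  · rcases K with _ | K
    · left
      rfl
    · right
      exact ⟨K, hK.2 K rfl, by simp⟩
  · rintro _ (rfl | ⟨n, hn, rfl⟩)
    · omega
    · have : n < K := by
        by_contra! h
        exact hn (hK.1 n h)
      simp only
      omega

lemma IsNumericalSemigroup.isSymmetricNS_iff {H : Set ℕ} (hH : IsNumericalSemigroup H) {K : ℕ}
    (hK : IsConductor H K) :
    IsSymmetricNS H ↔ ∀ x y, x + y + 1 = K → (x ∈ H ↔ y ∉ H) := by
  classical
  let A := (range K).filter (· ∉ H)
  let B := (range K).filter (· ∈ H)
  have hg : genus H = #A := by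
    rw [genus, ← Set.ncard_coe_finset]
    congr 1
    ext n
    simp only [A, Set.mem_compl_iff, coe_filter, mem_range, Set.mem_ofPred_eq]
    refine ⟨fun h => ⟨?_, h⟩, fun h => h.2⟩
    by_contra! hn
    exact h (hK.1 n hn)
  have hcard : #B + #A = K := by
    have := card_filter_add_card_filter_not (s := range K) (· ∈ H)
    rwa [card_range] at this
  have himg : B.image (fun x => K - 1 - x) ⊆ A := by
    intro y hy
    obtain ⟨x, hx, rfl⟩ := mem_image.1 hy
    obtain ⟨hx1, hx2⟩ := mem_filter.1 hx
    rw [mem_range] at hx1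
    refine mem_filter.2 ⟨mem_range.2 (by omega), fun hy => ?_⟩
    exact hK.2 (x + (K - 1 - x)) (by omega) (hH.2.1 _ hx2 _ hy)
  have hinj : #(B.image fun x => K - 1 - x) = #B := by
    refine card_image_of_injOn fun x hx y hy h => ?_
    have h1 := mem_range.1 (mem_filter.1 hx).1
    have h2 := mem_range.1 (mem_filter.1 hy).1
    omega
  rw [IsSymmetricNS, hg, hK.frobNum_eq]
  constructor
  · intro h x y hxy
    have heq := eq_of_subset_of_card_le himg (by omega)
    refine ⟨fun hx hy => hK.2 (x + y) hxy (hH.2.1 _ hx _ hy), fun hy => ?_⟩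
    have : y ∈ A := mem_filter.2 ⟨mem_range.2 (by omega), hy⟩
    rw [← heq] at this
    obtain ⟨z, hz, hzy⟩ := mem_image.1 this
    obtain ⟨hz1, hz2⟩ := mem_filter.1 hz
    rw [mem_range] at hz1
    have : z = x := by omega
    rwa [← this]
  · intro h
    have heq : B.image (fun x => K - 1 - x) = A := by
      refine himg.antisymm fun y hy => ?_
      obtain ⟨hy1, hy2⟩ := mem_filter.1 hy
      rw [mem_range] at hy1
      exact mem_image.2 ⟨K - 1 - y, mem_filter.2 ⟨mem_range.2 (by omega),
        (h _ y (by omega)).2 hy2⟩, by omega⟩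
    rw [heq] at hinj
    omega

lemma IsKunz.isSymmetricNS_iff {p : ℕ} [NeZero p] {W : ZMod p → ℤ} (hW : IsKunz p W) :
    IsSymmetricNS (aperySemigroup p W) ↔ ∃ τ, ∀ s, W s + W (τ - s) = W τ := by
  have hp0 : 0 < p := Nat.pos_of_ne_zero (NeZero.ne p)
  constructor
  · intro h
    obtain ⟨K, hK⟩ := exists_isConductor hW.isNumericalSemigroup.2.2
    rw [hW.isNumericalSemigroup.isSymmetricNS_iff hK] at h
    refine ⟨(K : ZMod p) - 1, ?_⟩
    have hτ : W (K - 1) = K - 1 + p := by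
      refine le_antisymm ?_ ?_
      · have h1 := hK.1 (K + p - 1) (by omega)
        simp only [aperySemigroup, Set.mem_ofPred_eq] at h1
        rw [Nat.cast_sub (by omega)] at h1
        push_cast [Nat.cast_sub (show 1 ≤ K + p by omega)] at h1
        simp only [CharP.cast_eq_zero, add_zero] at h1
        linarith
      · by_contra! hlt
        obtain ⟨n, h1, h2⟩ := hW.exists_natCast (K - 1)
        have h3 : (n : ℤ) ≤ K - 1 := by
          refine ZMod.le_of_intCast_eq_of_lt_add (p := p) ?_ (by omega)
          push_cast
          exact h2
        refine hK.2 (K - 1) (by omega) (?_ : W _ ≤ _)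
        rw [Nat.cast_sub (by omega), Nat.cast_sub (by omega), Nat.cast_one, ← h1]
        simpa using h3
    intro s
    refine le_antisymm ?_ ?_
    · obtain ⟨n, h1, h2⟩ := hW.exists_natCast s
      have hle : n ≤ K + p - 1 := by
        by_contra! hn
        have h4 := hK.1 (n - p) (by omega)
        simp only [aperySemigroup, Set.mem_ofPred_eq] at h4
        rw [Nat.cast_sub (by omega), Nat.cast_sub (by omega), ZMod.natCast_self, sub_zero, h2]
          at h4
        omega
      have hmem : K + p - 1 - n ∈ aperySemigroup p W := by
        by_cases hn : n < p
        · exact hK.1 _ (by omega)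
        · by_contra hc
          have h4 := (h (n - p) (K + p - 1 - n) (by omega)).2 hc
          simp only [aperySemigroup, Set.mem_ofPred_eq] at h4
          rw [Nat.cast_sub (by omega), Nat.cast_sub (by omega), ZMod.natCast_self, sub_zero, h2]
            at h4
          omega
      simp only [aperySemigroup, Set.mem_ofPred_eq] at hmem
      rw [Nat.cast_sub (by omega), Nat.cast_sub (by omega), Nat.cast_sub (by omega),
        Nat.cast_sub (by omega), h2] at hmem
      push_cast at hmem
      simp only [CharP.cast_eq_zero, add_zero] at hmem
      omega
    · have := hW.add_le s (K - 1 - s)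
      rwa [add_sub_cancel] at this
  · rintro ⟨τ, hτ⟩
    have hmax : ∀ s, W s ≤ W τ := fun s => by
      have h1 := hτ s
      have h2 := hW.nonneg (τ - s)
      omega
    have hlow : (p : ℤ) - 1 ≤ W τ := by
      refine le_trans ?_ (hmax (-1))
      have h1 := hW.nonneg (-1)
      by_contra! h2
      have h3 := ZMod.le_of_intCast_eq_of_lt_add (p := p) (a := W (-1)) (b := -1)
        (by rw [hW.cast_eq]; simp) (by omega)
      omega
    obtain ⟨T, hT⟩ : ∃ T : ℕ, (T : ℤ) = W τ := ⟨(W τ).toNat, by omega⟩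
    have hTτ : (T : ZMod p) = τ := by
      rw [← Int.cast_natCast, hT, hW.cast_eq]
    have hK : IsConductor (aperySemigroup p W) (T + 1 - p) := by
      refine ⟨fun n hn => hW.mem_of_lt_add ?_, fun n hn hmem => ?_⟩
      · have := hmax n
        omega
      · have h1 : (n : ZMod p) = τ := by
          have : T = n + p := by omega
          rw [← hTτ, this]
          simp
        simp only [aperySemigroup, Set.mem_ofPred_eq, h1] at hmem
        omega
    rw [hW.isNumericalSemigroup.isSymmetricNS_iff hK]
    intro x y hxy
    have h1 : (y : ZMod p) = τ - x := by
      have : T = x + y + p := by omega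
      rw [← hTτ, this]
      simp
    have h2 := hτ x
    simp only [aperySemigroup, Set.mem_ofPred_eq, h1, not_le]
    refine ⟨fun h => by omega, fun h => hW.mem_of_lt_add (by omega)⟩

/-- The Apéry tuples of the symmetric semigroups containing `p` and `q` whose largest entry sits in
the residue class `τ`. -/
def symKunz (p q : ℕ) (τ : ZMod p) : Set (ZMod p → ℤ) :=
  {W | IsKunz p W ∧ W q ≤ q ∧ ∀ s, W s + W (τ - s) = W τ}

lemma IsKunz.le_mul {p q : ℕ} [NeZero p] (hq : q.Coprime p) {W : ZMod p → ℤ} (hW : IsKunz p W)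
    (hWq : W q ≤ q) (s : ZMod p) : W s ≤ (p * q : ℕ) := by
  have h : ∀ t : ℕ, W (t * q) ≤ t * q := by
    intro t
    induction t with
    | zero => simp [hW.zero]
    | succ t ih =>
      have := hW.add_le (t * q) q
      push_cast
      rw [add_mul, add_mul, one_mul, one_mul]
      linarith
  have h1 := h (s * (q : ZMod p)⁻¹).val
  rw [ZMod.natCast_val, ZMod.cast_id', id, mul_assoc, mul_comm _ (q : ZMod p),
    ZMod.coe_mul_inv_eq_one q hq, mul_one] at h1
  have h2 := ZMod.val_lt (s * (q : ZMod p)⁻¹)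
  refine h1.trans ?_
  exact_mod_cast Nat.mul_le_mul_right q h2.le

lemma symKunz_subset_box {p q : ℕ} [NeZero p] (hq : q.Coprime p) (τ : ZMod p) :
    symKunz p q τ ⊆ (Fintype.piFinset fun _ : ZMod p => Icc 0 ((p * q : ℕ) : ℤ) :
      Finset (ZMod p → ℤ)) := by
  rintro W ⟨hW, hWq, -⟩
  rw [mem_coe, Fintype.mem_piFinset]
  exact fun s => mem_Icc.2 ⟨hW.nonneg s, hW.le_mul hq hWq s⟩

lemma symKunz_finite {p q : ℕ} [NeZero p] (hq : q.Coprime p) (τ : ZMod p) :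
    (symKunz p q τ).Finite :=
  (Finset.finite_toSet _).subset (symKunz_subset_box hq τ)

lemma countSym_eq_sum {p q : ℕ} [NeZero p] (hq : q.Coprime p) :
    countSym p q = ∑ τ : ZMod p, (symKunz p q τ).ncard := by
  have h1 : {H : Set ℕ | IsNumericalSemigroup H ∧ p ∈ H ∧ q ∈ H ∧ IsSymmetricNS H} =
      aperySemigroup p '' ⋃ τ : ZMod p, symKunz p q τ := by
    ext H
    constructor
    · rintro ⟨hH, hp, hqH, hsym⟩
      obtain ⟨W, hW, rfl⟩ := hH.exists_aperySemigroup_eq hp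
      obtain ⟨τ, hτ⟩ := hW.isSymmetricNS_iff.1 hsym
      exact ⟨W, Set.mem_iUnion.2 ⟨τ, hW, hqH, hτ⟩, rfl⟩
    · rintro ⟨W, hWτ, rfl⟩
      obtain ⟨τ, hW, hqH, hτ⟩ := Set.mem_iUnion.1 hWτ
      exact ⟨hW.isNumericalSemigroup, hW.modulus_mem, hqH, hW.isSymmetricNS_iff.2 ⟨τ, hτ⟩⟩
  have hinj : Set.InjOn (aperySemigroup p) (⋃ τ : ZMod p, symKunz p q τ) :=
    (aperySemigroup_injOn p).mono (Set.iUnion_subset fun τ W hW => hW.1)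
  rw [countSym, h1, hinj.ncard_image,
    Set.ncard_iUnion_of_finite (fun τ => symKunz_finite hq τ), finsum_eq_sum_of_fintype]
  intro τ τ' hne
  refine Set.disjoint_left.2 fun W hW hW' => hne ?_
  have h1 := hW.2.2 τ'
  have h2 := hW'.2.2 τ
  have h3 := hW.1.nonneg (τ - τ')
  have h4 := hW.1.nonneg (τ' - τ)
  rw [← hW.1.cast_eq τ, ← hW.1.cast_eq τ', show W τ = W τ' by omega]

/-- The indicator function of `P` is a piecewise quasi-polynomial on rational cones. -/
def IsConicPred {V : Type*} [AddCommGroup V] (P : V → Prop) : Prop :=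
  ∃ f ∈ conicQuasiPoly V, ∀ x, (P x → f x = 1) ∧ (¬ P x → f x = 0)

namespace IsConicPred

variable {V : Type*} [AddCommGroup V]

lemma congr {P Q : V → Prop} (hP : IsConicPred P) (h : ∀ x, P x ↔ Q x) : IsConicPred Q := by
  rwa [← funext fun x => propext (h x)]

lemma and {P Q : V → Prop} (hP : IsConicPred P) (hQ : IsConicPred Q) :
    IsConicPred fun x => P x ∧ Q x := by
  obtain ⟨f, hf, hf'⟩ := hP
  obtain ⟨g, hg, hg'⟩ := hQ
  refine ⟨f * g, mul_mem hf hg, fun x => ⟨fun h => ?_, fun h => ?_⟩⟩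
  · rw [Pi.mul_apply, (hf' x).1 h.1, (hg' x).1 h.2, one_mul]
  · rw [Pi.mul_apply]
    rcases not_and_or.1 h with h | h
    · rw [(hf' x).2 h, zero_mul]
    · rw [(hg' x).2 h, mul_zero]

lemma forall_mem {ι : Type*} {P : ι → V → Prop} (s : Finset ι) (hP : ∀ i ∈ s, IsConicPred (P i)) :
    IsConicPred fun x => ∀ i ∈ s, P i x := by
  classical
  induction s using Finset.induction_on with
  | empty => exact ⟨1, one_mem _, by simp⟩
  | insert a s _ ih =>
    simp only [Finset.forall_mem_insert] at hP ⊢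
    exact hP.1.and (ih hP.2)

lemma all {ι : Type*} [Fintype ι] {P : ι → V → Prop} (hP : ∀ i, IsConicPred (P i)) :
    IsConicPred fun x => ∀ i, P i x := by
  simpa using forall_mem univ fun i _ => hP i

lemma le (ℓ m : V →+ ℤ) : IsConicPred fun x => ℓ x ≤ m x :=
  ⟨_, le_mem_conicQuasiPoly ℓ m, fun _ => ⟨fun h => if_pos h, fun h => if_neg h⟩⟩

lemma eq (ℓ m : V →+ ℤ) : IsConicPred fun x => ℓ x = m x :=
  ⟨_, eq_mem_conicQuasiPoly ℓ m, fun _ => ⟨fun h => if_pos h, fun h => if_neg h⟩⟩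

lemma cast_eq {p : ℕ} [NeZero p] (ℓ : V →+ ℤ) (s : ZMod p) :
    IsConicPred fun x => (ℓ x : ZMod p) = s := by
  refine ⟨_, periodic_mem_conicQuasiPoly ℓ (g := fun t => if (t : ZMod p) = s then 1 else 0)
    ⟨p, Nat.pos_of_ne_zero (NeZero.ne p), fun t => by simp⟩,
    fun _ => ⟨fun h => if_pos h, fun h => if_neg h⟩⟩

end IsConicPred

lemma isConicPred_symKunz {p : ℕ} [NeZero p] (ι τ : ZMod p) :
    IsConicPred fun x : ℤ × (ZMod p → ℤ) =>
      IsKunz p x.2 ∧ x.2 ι ≤ x.1 ∧ ∀ s, x.2 s + x.2 (τ - s) = x.2 τ := by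
  let Q : ℤ × (ZMod p → ℤ) →+ ℤ := AddMonoidHom.fst _ _
  let E : ZMod p → (ℤ × (ZMod p → ℤ) →+ ℤ) := fun s =>
    (Pi.evalAddMonoidHom (fun _ => ℤ) s).comp (AddMonoidHom.snd _ _)
  have hkunz : IsConicPred fun x : ℤ × (ZMod p → ℤ) => (∀ s, (E s x : ZMod p) = s) ∧
      E 0 x = (0 : ℤ × (ZMod p → ℤ) →+ ℤ) x ∧
      (∀ s, (0 : ℤ × (ZMod p → ℤ) →+ ℤ) x ≤ E s x) ∧ ∀ a b, E (a + b) x ≤ (E a + E b) x :=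
    (IsConicPred.all fun s => .cast_eq (E s) s).and <| (IsConicPred.eq (E 0) 0).and <|
      (IsConicPred.all fun s => .le 0 (E s)).and <|
        IsConicPred.all fun a => IsConicPred.all fun b => .le (E (a + b)) (E a + E b)
  have hall := hkunz.and <| (IsConicPred.le (E ι) Q).and <|
    IsConicPred.all fun s => .eq (E s + E (τ - s)) (E τ)
  refine hall.congr fun x => and_congr_left' ?_
  exact ⟨fun h => ⟨h.1, h.2.1, h.2.2.1, h.2.2.2⟩, fun h => ⟨h.1, h.2, h.3, h.4⟩⟩

lemma exists_isConstituents_countSym {p i : ℕ} [NeZero p] (hi : 1 ≤ i) (hcop : i.Coprime p) :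
    ∃ N c, IsConstituents (fun n => (countSym p (i + n * p) : ℝ)) N c := by
  choose f hf hf' using fun τ => isConicPred_symKunz (p := p) (i : ZMod p) τ
  have hsum : (fun q : ℤ => ∑ τ, ∑ W ∈ Fintype.piFinset fun _ : ZMod p =>
      Icc 0 (((p : ℤ) • AddMonoidHom.id ℤ) q), f τ (q, W)) ∈ conicQuasiPoly ℤ := by
    have := sum_mem (S := conicQuasiPoly ℤ) (t := univ) fun τ _ =>
      sum_pi_mem_conicQuasiPoly (hf τ) ((p : ℤ) • AddMonoidHom.id ℤ)
    convert this using 1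
    ext q
    rw [Finset.sum_apply]
  obtain ⟨N, c, hc⟩ := exists_isConstituents_of_mem_conicQuasiPoly hsum hi p
  refine ⟨N, c, hc.1, fun n => ?_⟩
  rw [← hc.2 n]
  have hq : (i + n * p).Coprime p := by simpa using hcop
  simp only
  rw [countSym_eq_sum hq, Nat.cast_sum]
  refine sum_congr rfl fun τ _ => ?_
  classical
  have hset : symKunz p (i + n * p) τ = ((Fintype.piFinset fun _ : ZMod p =>
      Icc 0 (((p : ℤ) • AddMonoidHom.id ℤ) (i + n * p : ℕ))).filter fun W =>
        W ∈ symKunz p (i + n * p) τ : Finset (ZMod p → ℤ)) := by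
    ext W
    rw [mem_coe, mem_filter]
    refine ⟨fun h => ⟨?_, h⟩, fun h => h.2⟩
    have hbox := symKunz_subset_box hq τ h
    rw [mem_coe, Fintype.mem_piFinset] at hbox
    simpa using hbox
  rw [hset, Set.ncard_coe_finset, card_filter, Nat.cast_sum]
  refine sum_congr rfl fun W _ => ?_
  have hcast : ((i + n * p : ℕ) : ZMod p) = i := by simp
  have hiff : W ∈ symKunz p (i + n * p) τ ↔
      IsKunz p W ∧ W i ≤ (i + n * p : ℕ) ∧ ∀ s, W s + W (τ - s) = W τ := by
    rw [symKunz, hcast, Set.mem_ofPred_eq]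
  split_ifs with h
  · rw [(hf' τ (_, W)).1 (hiff.1 h), Nat.cast_one]
  · rw [(hf' τ (_, W)).2 fun h' => h (hiff.2 h'), Nat.cast_zero]

/-- `τ ≠ 0` has the only half `a` (when `e = 2`), or it has no half and `a = τ` (when `e = 1`). -/
structure IsHalf {p : ℕ} (τ a : ZMod p) (e : ℕ) : Prop where
  ne_zero : τ ≠ 0
  cases : e = 1 ∧ a = τ ∨ e = 2 ∧ a + a = τ
  eq_of_add_self : ∀ h, h + h = τ → h = a ∧ e = 2

/-- The residues that are smaller than their reflection in `τ`. -/
def lowHalf {p : ℕ} [NeZero p] (τ : ZMod p) : Finset (ZMod p) :=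
  univ.filter fun s => s.val < (τ - s).val

/-- The extension of a tuple from the coordinates in `insert a ((lowHalf τ).erase 0)` to the
tuple vanishing at `0` whose coordinates at `s` and `τ - s` have the same sum for all `s`. -/
def symExtend {p : ℕ} [NeZero p] (τ a : ZMod p) (e : ℕ) {R : Type*} [CommRing R]
    (x : ZMod p → R) (s : ZMod p) : R :=
  if s ∈ lowHalf τ then Function.update x 0 0 s
  else if τ - s ∈ lowHalf τ then e * x a - Function.update x 0 0 (τ - s)
  else x a

/-- The coordinates that determine a tuple in the image of `symExtend`. -/
def symCoords {p : ℕ} [NeZero p] (τ a : ZMod p) : Finset (ZMod p) :=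
  insert a ((lowHalf τ).erase 0)

section

variable {p : ℕ} [NeZero p] {τ a s : ZMod p} {e : ℕ} {R : Type*} [CommRing R]

lemma mem_lowHalf : s ∈ lowHalf τ ↔ s.val < (τ - s).val := by simp [lowHalf]

lemma sub_notMem_lowHalf (hs : s ∈ lowHalf τ) : τ - s ∉ lowHalf τ := by
  rw [mem_lowHalf] at hs ⊢
  rw [sub_sub_cancel]
  omega

lemma add_self_eq_of_notMem_lowHalf (h1 : s ∉ lowHalf τ) (h2 : τ - s ∉ lowHalf τ) : s + s = τ := by
  rw [mem_lowHalf] at h1 h2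
  rw [sub_sub_cancel] at h2
  have h : s = τ - s := ZMod.val_injective p (by omega)
  nth_rewrite 2 [h]
  exact add_sub_cancel s τ

namespace IsHalf

variable (h : IsHalf τ a e)
include h

lemma zero_mem_lowHalf : 0 ∈ lowHalf τ := by
  rw [mem_lowHalf, ZMod.val_zero, sub_zero]
  exact Nat.pos_of_ne_zero fun hv => h.ne_zero ((ZMod.val_eq_zero τ).1 hv)

lemma self_notMem_lowHalf : τ ∉ lowHalf τ := by
  simpa using sub_notMem_lowHalf h.zero_mem_lowHalf

lemma half_notMem_lowHalf : a ∉ lowHalf τ := by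
  rcases h.cases with ⟨-, rfl⟩ | ⟨-, rfl⟩
  · exact h.self_notMem_lowHalf
  · simp [mem_lowHalf]

lemma card_symCoords : #(symCoords τ a) = p / 2 := by
  have h1 : #(symCoords τ a) = #(lowHalf τ) := by
    rw [symCoords, card_insert_of_notMem fun ha => h.half_notMem_lowHalf (mem_of_mem_erase ha),
      card_erase_add_one h.zero_mem_lowHalf]
  let S : Finset (ZMod p) := univ.filter fun s => s + s = τ
  have h2 : #S ≤ 1 := card_le_one.2 fun x hx y hy =>
    (h.eq_of_add_self x (mem_filter.1 hx).2).1.trans (h.eq_of_add_self y (mem_filter.1 hy).2).1.symm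
  have hdisj : Disjoint (lowHalf τ) ((lowHalf τ).image (τ - ·)) := by
    rw [disjoint_left]
    intro s hs hs'
    obtain ⟨t, ht, rfl⟩ := mem_image.1 hs'
    exact sub_notMem_lowHalf ht hs
  have hdisj' : Disjoint (lowHalf τ ∪ (lowHalf τ).image (τ - ·)) S := by
    rw [disjoint_right]
    intro s hs
    obtain rfl := (mem_filter.1 hs).2
    rw [mem_union, mem_image]
    rintro (hs' | ⟨t, ht, hts⟩)
    · simp [mem_lowHalf] at hs'
    · obtain rfl : t = s := by linear_combination -hts
      simp [mem_lowHalf] at ht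
  have huniv : lowHalf τ ∪ (lowHalf τ).image (τ - ·) ∪ S = univ := by
    refine eq_univ_of_forall fun s => ?_
    simp only [mem_union, mem_image, S, mem_filter, mem_univ, true_and]
    by_cases h1 : s ∈ lowHalf τ
    · exact .inl (.inl h1)
    by_cases h2 : τ - s ∈ lowHalf τ
    · exact .inl (.inr ⟨_, h2, sub_sub_cancel _ _⟩)
    · exact .inr (add_self_eq_of_notMem_lowHalf h1 h2)
  have hcard := congrArg card huniv
  rw [card_union_of_disjoint hdisj', card_union_of_disjoint hdisj,
    card_image_of_injective _ (sub_right_injective (b := τ)), card_univ, ZMod.card] at hcard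
  omega

lemma symExtend_zero (x : ZMod p → R) : symExtend τ a e x 0 = 0 := by
  simp [symExtend, h.zero_mem_lowHalf]

lemma symExtend_self (x : ZMod p → R) : symExtend τ a e x τ = e * x a := by
  simp [symExtend, h.zero_mem_lowHalf, h.self_notMem_lowHalf]

lemma symExtend_add_symExtend (x : ZMod p → R) (s : ZMod p) :
    symExtend τ a e x s + symExtend τ a e x (τ - s) = symExtend τ a e x τ := by
  rw [h.symExtend_self]
  by_cases h1 : s ∈ lowHalf τ
  · simp [symExtend, h1, sub_notMem_lowHalf h1]
  by_cases h2 : τ - s ∈ lowHalf τ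
  · simp [symExtend, h1, h2]
  · obtain ⟨-, rfl⟩ := h.eq_of_add_self s (add_self_eq_of_notMem_lowHalf h1 h2)
    simp [symExtend, h1, h2]
    ring

lemma symExtend_of_mem_symCoords (x : ZMod p → R) (hs : s ∈ symCoords τ a) :
    symExtend τ a e x s = x s := by
  rcases mem_insert.1 hs with rfl | hs
  · rcases h.cases with ⟨rfl, rfl⟩ | ⟨-, hs⟩
    · rw [h.symExtend_self, Nat.cast_one, one_mul]
    · have := h.half_notMem_lowHalf
      have h2 : τ - s = s := by rw [← hs, add_sub_cancel_right]
      simp [symExtend, this, h2]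
  · obtain ⟨h0, hs⟩ := mem_erase.1 hs
    simp [symExtend, hs, h0]

lemma symExtend_eq_self {x : ZMod p → R} (h0 : x 0 = 0) (hx : ∀ s, x s + x (τ - s) = x τ) :
    symExtend τ a e x = x := by
  have hupd : Function.update x 0 0 = x := by rw [← h0, Function.update_eq_self]
  have ha : e * x a = x τ := by
    rcases h.cases with ⟨rfl, rfl⟩ | ⟨rfl, hs⟩
    · rw [Nat.cast_one, one_mul]
    · have h2 : τ - a = a := by rw [← hs, add_sub_cancel_right]
      rw [← hx a, h2]
      push_cast
      ring
  ext s
  rw [symExtend, hupd, ha]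
  split_ifs with h1 h2
  · rfl
  · rw [← hx s, add_sub_cancel_right]
  · rw [(h.eq_of_add_self s (add_self_eq_of_notMem_lowHalf h1 h2)).1]

end IsHalf

lemma symExtend_congr {x y : ZMod p → R} (hxy : ∀ s ∈ symCoords τ a, x s = y s) :
    symExtend τ a e x = symExtend τ a e y := by
  have hupd : ∀ s ∈ lowHalf τ, Function.update x 0 0 s = Function.update y 0 0 s := by
    intro s hs
    by_cases h0 : s = 0
    · simp [h0]
    · simpa [h0] using hxy s (mem_insert_of_mem (mem_erase.2 ⟨h0, hs⟩))
  have ha := hxy a (mem_insert_self _ _)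
  ext s
  rw [symExtend, symExtend, ha]
  split_ifs with h1 h2
  · exact hupd s h1
  · rw [hupd _ h2]
  · rfl

lemma map_symExtend {S : Type*} [CommRing S] (f : R →+* S) (x : ZMod p → R) (s : ZMod p) :
    f (symExtend τ a e x s) = symExtend τ a e (fun t => f (x t)) s := by
  have hupd : ∀ s, f (Function.update x 0 0 s) = Function.update (fun t => f (x t)) 0 0 s := by
    intro s
    by_cases h0 : s = 0 <;> simp [h0]
  unfold symExtend
  split_ifs <;> simp [hupd]

lemma symExtend_combo (x y : ZMod p → R) (α β : R) (s : ZMod p) :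
    symExtend τ a e (fun t => α * x t + β * y t) s =
      α * symExtend τ a e x s + β * symExtend τ a e y s := by
  have hupd : ∀ s, Function.update (fun t => α * x t + β * y t) 0 0 s =
      α * Function.update x 0 0 s + β * Function.update y 0 0 s := by
    intro s
    by_cases h0 : s = 0 <;> simp [h0]
  unfold symExtend
  split_ifs <;> simp [hupd]
  ring

end

/-- The real analogues of the Apéry tuples, normalised so that the bound at the class `ι` is `1`. -/
def kunzPolytope {p : ℕ} (ι : ZMod p) : Set (ZMod p → ℝ) :=
  {W | (∀ s, 0 ≤ W s) ∧ (∀ a b, W (a + b) ≤ W a + W b) ∧ W ι ≤ 1}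

/-- The affine parametrisation of the tuples with reflection symmetry in `τ` by the coordinates in
`symCoords τ a`; for `q` in the class `ι`, the Apéry tuples divided by `q` correspond to points
of `q⁻¹ ℤ`. -/
noncomputable def symParam {p : ℕ} [NeZero p] (ι τ a : ZMod p) (e : ℕ)
    (u : symCoords τ a → ℝ) : ZMod p → ℝ :=
  symExtend τ a e fun t =>
    ((ι⁻¹ * t).val : ℝ) + p * if h : t ∈ symCoords τ a then u ⟨t, h⟩ else 0

section

variable {p : ℕ} [NeZero p] {ι τ a s : ZMod p} {e : ℕ}

omit [NeZero p] in
lemma convex_kunzPolytope : Convex ℝ (kunzPolytope ι) := by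
  rintro x ⟨hx1, hx2, hx3⟩ y ⟨hy1, hy2, hy3⟩ α β hα hβ hαβ
  refine ⟨fun s => ?_, fun s t => ?_, ?_⟩ <;>
    simp only [Pi.add_apply, Pi.smul_apply, smul_eq_mul]
  · have := mul_nonneg hα (hx1 s)
    have := mul_nonneg hβ (hy1 s)
    linarith
  · have := mul_le_mul_of_nonneg_left (hx2 s t) hα
    have := mul_le_mul_of_nonneg_left (hy2 s t) hβ
    linarith
  · have := mul_le_mul_of_nonneg_left hx3 hα
    have := mul_le_mul_of_nonneg_left hy3 hβ
    linarith

omit [NeZero p] in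
lemma isClosed_kunzPolytope : IsClosed (kunzPolytope ι) := by
  simp only [kunzPolytope, Set.ofPred_and, Set.ofPred_forall]
  refine (isClosed_iInter fun s => ?_).inter ((isClosed_iInter fun s => isClosed_iInter fun t =>
    ?_).inter ?_)
  · exact isClosed_le continuous_const (continuous_apply s)
  · exact isClosed_le (continuous_apply _) ((continuous_apply s).add (continuous_apply t))
  · exact isClosed_le (continuous_apply ι) continuous_const

lemma le_of_mem_kunzPolytope (hι : IsUnit ι) {W : ZMod p → ℝ} (hW : W ∈ kunzPolytope ι)
    (h0 : W 0 = 0) (s : ZMod p) : W s ≤ p := by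
  obtain ⟨-, hadd, h1⟩ := hW
  have h : ∀ t : ℕ, W (t * ι) ≤ t := by
    intro t
    induction t with
    | zero => simp [h0]
    | succ t ih =>
      have := hadd (t * ι) ι
      push_cast
      rw [add_mul, one_mul]
      linarith
  obtain ⟨v, rfl⟩ := hι
  have h2 := h (s * ↑v⁻¹).val
  rw [ZMod.natCast_val, ZMod.cast_id', id, Units.inv_mul_cancel_right] at h2
  exact h2.trans (by exact_mod_cast (ZMod.val_lt _).le)

lemma continuous_symExtend : Continuous (symExtend τ a e : (ZMod p → ℝ) → ZMod p → ℝ) := by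
  refine continuous_pi fun s => ?_
  have hupd : ∀ s, Continuous fun x : ZMod p → ℝ => Function.update x 0 0 s := fun s =>
    (continuous_apply s).comp (continuous_id.update 0 continuous_const)
  unfold symExtend
  split_ifs
  · exact hupd s
  · exact (continuous_const.mul (continuous_apply a)).sub (hupd _)
  · exact continuous_apply a

lemma continuous_symParam : Continuous (symParam ι τ a e) := by
  refine continuous_symExtend.comp (continuous_pi fun s => ?_)
  split_ifs <;> fun_prop

lemma convex_preimage_symParam : Convex ℝ (symParam ι τ a e ⁻¹' kunzPolytope ι) := by
  intro u hu v hv α β hα hβ hαβ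
  have h : symParam ι τ a e (α • u + β • v) =
      α • symParam ι τ a e u + β • symParam ι τ a e v := by
    ext s
    simp only [symParam, Pi.add_apply, Pi.smul_apply, smul_eq_mul]
    rw [← symExtend_combo]
    congr 1
    ext t
    split_ifs <;> linear_combination -hαβ * ((ι⁻¹ * t).val : ℝ)
  rw [Set.mem_preimage, h]
  exact convex_kunzPolytope hu hv hα hβ hαβ

namespace IsHalf

variable (h : IsHalf τ a e)
include h

lemma symParam_apply (u : symCoords τ a → ℝ) (s : symCoords τ a) :
    symParam ι τ a e u s = (ι⁻¹ * s).val + p * u s := by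
  rw [symParam, h.symExtend_of_mem_symCoords _ s.2]
  simp

lemma isBounded_preimage_symParam (hι : IsUnit ι) :
    Bornology.IsBounded (symParam ι τ a e ⁻¹' kunzPolytope ι) := by
  have hp : (0 : ℝ) < p := by exact_mod_cast Nat.pos_of_ne_zero (NeZero.ne p)
  refine (Metric.isBounded_Icc (fun _ => -1) fun _ => 1).subset
    fun u hu => ⟨fun s => ?_, fun s => ?_⟩
  · have h1 := hu.1 s
    rw [h.symParam_apply] at h1
    have h2 : ((ι⁻¹ * s).val : ℝ) ≤ p := by exact_mod_cast (ZMod.val_lt _).le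
    show (-1 : ℝ) ≤ u s
    nlinarith
  · have h1 := le_of_mem_kunzPolytope hι hu (h.symExtend_zero _) s
    rw [h.symParam_apply] at h1
    have h2 : (0 : ℝ) ≤ (ι⁻¹ * s).val := Nat.cast_nonneg _
    show u s ≤ 1
    nlinarith

lemma symExtend_mem_kunzPolytope {x : ZMod p → ℝ}
    (hx : ∀ s ∈ symCoords τ a, |x s - if s = a then 1 / (2 * (e : ℝ)) else 1 / 4| < 1 / 100) :
    symExtend τ a e x ∈ kunzPolytope ι := by
  have ha := abs_lt.1 (hx a (mem_insert_self _ _))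
  rw [if_pos rfl] at ha
  have hτ : 1 / 2 - 2 / 100 ≤ symExtend τ a e x τ ∧ symExtend τ a e x τ ≤ 1 / 2 + 2 / 100 := by
    rw [h.symExtend_self]
    rcases h.cases with ⟨rfl, -⟩ | ⟨rfl, -⟩ <;> norm_num at ha ⊢ <;> constructor <;> linarith
  have hlow : ∀ s ∈ lowHalf τ, s ≠ 0 → |x s - 1 / 4| < 1 / 100 := by
    intro s hs h0
    have := hx s (mem_insert_of_mem (mem_erase.2 ⟨h0, hs⟩))
    have hsa : s ≠ a := fun hsa => h.half_notMem_lowHalf (hsa ▸ hs)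
    rwa [if_neg hsa] at this
  have hmid : ∀ s, s ≠ 0 → s ≠ τ →
      1 / 4 - 3 / 100 ≤ symExtend τ a e x s ∧ symExtend τ a e x s ≤ 1 / 4 + 3 / 100 := by
    intro s h0 hsτ
    by_cases h1 : s ∈ lowHalf τ
    · have := abs_lt.1 (hlow s h1 h0)
      simp only [symExtend, h1, if_true, Function.update_of_ne h0]
      constructor <;> linarith
    by_cases h2 : τ - s ∈ lowHalf τ
    · have := abs_lt.1 (hlow _ h2 (sub_ne_zero.2 hsτ.symm))
      have hadd := h.symExtend_add_symExtend x s
      have : symExtend τ a e x (τ - s) = x (τ - s) := by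
        simp [symExtend, h2, sub_ne_zero.2 hsτ.symm]
      constructor <;> linarith
    · obtain ⟨rfl, rfl⟩ := h.eq_of_add_self s (add_self_eq_of_notMem_lowHalf h1 h2)
      simp only [symExtend, h1, h2, if_false]
      norm_num at ha
      constructor <;> linarith
  have hpos : ∀ s, s ≠ 0 → 1 / 4 - 3 / 100 ≤ symExtend τ a e x s := by
    intro s h0
    by_cases hs : s = τ
    · subst hs
      linarith
    · exact (hmid s h0 hs).1
  have hle : ∀ s, s ≠ τ → symExtend τ a e x s ≤ 1 / 4 + 3 / 100 := by
    intro s hs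
    by_cases h0 : s = 0
    · rw [h0, h.symExtend_zero]
      norm_num
    · exact (hmid s h0 hs).2
  refine ⟨fun s => ?_, fun s t => ?_, ?_⟩
  · by_cases h0 : s = 0
    · rw [h0, h.symExtend_zero]
    · linarith [hpos s h0]
  · by_cases hs : s = 0
    · rw [hs, zero_add, h.symExtend_zero, zero_add]
    by_cases ht : t = 0
    · rw [ht, add_zero, h.symExtend_zero, add_zero]
    by_cases hst : s + t = τ
    · have := h.symExtend_add_symExtend x s
      rw [← hst, add_sub_cancel_left] at this
      rw [← hst, this]
    · linarith [hpos s hs, hpos t ht, hle _ hst]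
  · by_cases hs : ι = τ
    · rw [hs]
      linarith
    · linarith [hle ι hs]

lemma volume_preimage_symParam_pos (hι : IsUnit ι) :
    0 < MeasureTheory.volume.real (symParam ι τ a e ⁻¹' kunzPolytope ι) := by
  have hp : (p : ℝ) ≠ 0 := by exact_mod_cast NeZero.ne p
  let U : Set (symCoords τ a → ℝ) := {u | ∀ s : symCoords τ a,
    |((ι⁻¹ * s).val + p * u s) - if (s : ZMod p) = a then 1 / (2 * (e : ℝ)) else 1 / 4| < 1 / 100}
  have hU : IsOpen U := by
    simp only [U, Set.ofPred_forall]
    exact isOpen_iInter_of_finite fun s => isOpen_lt (by fun_prop) continuous_const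
  have hne : U.Nonempty := by
    refine ⟨fun s => ((if (s : ZMod p) = a then 1 / (2 * (e : ℝ)) else 1 / 4) -
      (ι⁻¹ * s).val) / p, fun s => ?_⟩
    rw [mul_div_cancel₀ _ hp, add_sub_cancel, sub_self, abs_zero]
    norm_num
  have hsub : U ⊆ symParam ι τ a e ⁻¹' kunzPolytope ι := fun u hu =>
    h.symExtend_mem_kunzPolytope fun s hs => by simpa [hs] using hu ⟨s, hs⟩
  refine ENNReal.toReal_pos ?_ (h.isBounded_preimage_symParam hι).measure_lt_top.ne
  exact ((hU.measure_pos _ hne).trans_le (MeasureTheory.measure_mono hsub)).ne'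

end IsHalf

end

section

variable {p : ℕ} [NeZero p] {ι τ a : ZMod p} {e : ℕ}

open scoped Pointwise in
lemma IsHalf.natCard_preimage_symParam_inter (h : IsHalf τ a e) (hι : IsUnit ι) {q : ℕ}
    [NeZero q] (hq : (q : ZMod p) = ι) :
    Nat.card ↑((symParam ι τ a e ⁻¹' kunzPolytope ι) ∩ (q : ℝ)⁻¹ •
      (Submodule.span ℤ (Set.range (Pi.basisFun ℝ (symCoords τ a))) :
        Set (symCoords τ a → ℝ))) = (symKunz p q τ).ncard := by
  have hp : (p : ℝ) ≠ 0 := by exact_mod_cast NeZero.ne p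
  have hq0 : (0 : ℝ) < q := by exact_mod_cast Nat.pos_of_ne_zero (NeZero.ne q)
  have hlift : ∀ s : ZMod p, ((q * (ι⁻¹ * s).val : ℕ) : ZMod p) = s := by
    intro s
    rw [Nat.cast_mul, ZMod.natCast_val, ZMod.cast_id', id, hq, ← mul_assoc,
      ZMod.mul_inv_of_unit ι hι, one_mul]
  let G : (ZMod p → ℤ) → symCoords τ a → ℝ := fun W s => ((W s : ℝ) / q - (ι⁻¹ * s).val) / p
  have hG : ∀ W ∈ symKunz p q τ, symParam ι τ a e (G W) = fun s => (W s : ℝ) / q := by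
    rintro W ⟨hW, -, hsym⟩
    rw [← h.symExtend_eq_self (x := fun s => (W s : ℝ) / q) (by simp [hW.zero]) fun s => ?_]
    · refine symExtend_congr fun s hs => ?_
      rw [dif_pos hs, mul_div_cancel₀ _ hp, add_sub_cancel]
    · rw [← add_div, ← Int.cast_add, hsym]
  have hinj : Set.InjOn G (symKunz p q τ) := by
    intro W hW W' hW' hGG
    have h1 := hG W hW
    rw [hGG, hG W' hW'] at h1
    ext s
    have h2 := congrFun h1 s
    rw [div_left_inj' hq0.ne'] at h2
    exact_mod_cast h2.symm
  have himage : G '' symKunz p q τ = (symParam ι τ a e ⁻¹' kunzPolytope ι) ∩ (q : ℝ)⁻¹ •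
      (Submodule.span ℤ (Set.range (Pi.basisFun ℝ (symCoords τ a))) :
        Set (symCoords τ a → ℝ)) := by
    ext u
    rw [Set.mem_inter_iff, ← Submodule.coe_pointwise_smul, SetLike.mem_coe,
      BoxIntegral.unitPartition.mem_smul_span_iff]
    constructor
    · rintro ⟨W, hWmem, rfl⟩
      obtain ⟨hW, hWq, hsym⟩ := id hWmem
      constructor
      · rw [Set.mem_preimage, hG W hWmem]
        refine ⟨fun s => ?_, fun s t => ?_, ?_⟩
        · have : (0 : ℝ) ≤ W s := by exact_mod_cast hW.nonneg s
          positivity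
        · rw [← add_div]
          refine div_le_div_of_nonneg_right ?_ hq0.le
          exact_mod_cast hW.add_le s t
        · rw [div_le_one hq0]
          rw [hq] at hWq
          exact_mod_cast hWq
      · intro s
        have hcast : ((W s : ℤ) : ZMod p) = ((q * (ι⁻¹ * s).val : ℕ) : ℤ) := by
          rw [hW.cast_eq, Int.cast_natCast, hlift]
        obtain ⟨k, hk⟩ := ZMod.exists_eq_add_mul_of_intCast_eq hcast
        refine ⟨k, ?_⟩
        simp only [G, hk, algebraMap_int_eq, eq_intCast]
        push_cast
        field_simp
        ring
    · rintro ⟨hu, hz⟩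
      choose z hz using hz
      let x : ZMod p → ℤ := fun t =>
        (q * (ι⁻¹ * t).val : ℕ) + p * if ht : t ∈ symCoords τ a then z ⟨t, ht⟩ else 0
      have hxu : ∀ s, ((symExtend τ a e x s : ℤ) : ℝ) / q = symParam ι τ a e u s := by
        intro s
        have h1 := map_symExtend (τ := τ) (a := a) (e := e) (Int.castRingHom ℝ) x s
        have h2 := symExtend_combo (τ := τ) (a := a) (e := e)
          (fun t => (x t : ℝ)) 0 (q : ℝ)⁻¹ 0 s
        rw [eq_intCast] at h1
        simp only [eq_intCast] at h1
        rw [h1, div_eq_inv_mul]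
        simp only [zero_mul, add_zero] at h2
        rw [← h2, symParam]
        refine congrFun (symExtend_congr fun t ht => ?_) s
        have h3 := hz ⟨t, ht⟩
        simp only [algebraMap_int_eq, eq_intCast] at h3
        simp only [x, dif_pos ht]
        push_cast
        rw [h3]
        field_simp
      have hcast : ∀ s, ((symExtend τ a e x s : ℤ) : ZMod p) = s := by
        intro s
        have h1 := map_symExtend (τ := τ) (a := a) (e := e) (Int.castRingHom (ZMod p)) x s
        have h2 : (fun t => Int.castRingHom (ZMod p) (x t)) = fun t => t := by
          ext t
          have := hlift t
          simp only [x, eq_intCast]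
          rw [Int.cast_add, Int.cast_mul, Int.cast_natCast, Int.cast_natCast, ZMod.natCast_self,
            zero_mul, add_zero, this]
        rw [h2, h.symExtend_eq_self rfl fun s => add_sub_cancel s τ] at h1
        exact h1
      obtain ⟨hu1, hu2, hu3⟩ := hu
      simp only [← hxu] at hu1 hu2 hu3
      refine ⟨symExtend τ a e x, ⟨⟨hcast, h.symExtend_zero x, fun s => ?_, fun s t => ?_⟩, ?_,
        h.symExtend_add_symExtend x⟩, ?_⟩
      · have := hu1 s
        rw [le_div_iff₀ hq0, zero_mul] at this
        exact_mod_cast this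
      · have := hu2 s t
        rw [← add_div, div_le_div_iff_of_pos_right hq0] at this
        exact_mod_cast this
      · rw [hq]
        rw [div_le_one hq0] at hu3
        exact_mod_cast hu3
      · ext s
        have := hxu s
        rw [h.symParam_apply] at this
        simp only [G, this]
        field_simp
        ring
  rw [← himage, Nat.card_coe_set_eq, hinj.ncard_image]

open Filter Topology in
lemma IsHalf.tendsto_ncard_symKunz (h : IsHalf τ a e) {i : ℕ} (hi : 1 ≤ i) (hcop : i.Coprime p) :
    ∃ V : ℝ, 0 < V ∧ Tendsto (fun n : ℕ => ((symKunz p (i + n * p) τ).ncard : ℝ) /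
      ((i + n * p : ℕ) : ℝ) ^ (p / 2)) atTop (𝓝 V) := by
  have hι : IsUnit (i : ZMod p) := (ZMod.isUnit_iff_coprime i p).2 hcop
  have hbdd := h.isBounded_preimage_symParam hι
  have hmeas : IsClosed (symParam (i : ZMod p) τ a e ⁻¹' kunzPolytope (i : ZMod p)) :=
    isClosed_kunzPolytope.preimage continuous_symParam
  have hlim := tendsto_card_div_pow_atTop_volume _ hbdd hmeas.measurableSet
    (convex_preimage_symParam.addHaar_frontier MeasureTheory.volume)
  refine ⟨_, h.volume_preimage_symParam_pos hι, ?_⟩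
  have hto : Tendsto (fun n : ℕ => i + n * p) atTop atTop :=
    tendsto_atTop_mono (fun n => (Nat.le_mul_of_pos_right n
      (Nat.pos_of_ne_zero (NeZero.ne p))).trans (Nat.le_add_left _ i)) tendsto_id
  refine (hlim.comp hto).congr fun n => ?_
  have : NeZero (i + n * p) := ⟨by omega⟩
  rw [Function.comp_apply, h.natCard_preimage_symParam_inter hι (by simp), Fintype.card_coe,
    h.card_symCoords]

lemma symKunz_eq_empty_of_not_isHalf {q : ℕ} (hp : 3 ≤ p) (h : ¬ ∃ a e, IsHalf τ a e) :
    symKunz p q τ = ∅ := by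
  have : Fact (1 < p) := ⟨by omega⟩
  by_contra hne
  obtain ⟨W, hW, -, hsym⟩ := Set.nonempty_iff_ne_empty.2 hne
  have hinj : ∀ s t, W s = W t → s = t := fun s t hst => by
    rw [← hW.cast_eq s, hst, hW.cast_eq]
  refine h ?_
  have h0 : τ ≠ 0 := by
    rintro rfl
    have h1 := hsym 1
    have h2 := hW.nonneg 1
    have h3 := hW.nonneg (0 - 1)
    have h4 := hW.zero
    exact one_ne_zero (hinj 1 0 (by omega))
  by_cases hex : ∃ a, a + a = τ
  · obtain ⟨a, ha⟩ := hex
    refine ⟨a, 2, h0, .inr ⟨rfl, ha⟩, fun b hb => ⟨hinj _ _ ?_, rfl⟩⟩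
    have h1 := hsym a
    have h2 := hsym b
    rw [← ha, add_sub_cancel_right] at h1
    rw [← hb, add_sub_cancel_right] at h2
    rw [ha] at h1
    rw [hb] at h2
    omega
  · exact ⟨τ, 1, h0, .inl ⟨rfl, rfl⟩, fun b hb => (hex ⟨b, hb⟩).elim⟩

omit [NeZero p] in
lemma exists_isHalf_one (hp : 3 ≤ p) : ∃ (a : ZMod p) (e : ℕ), IsHalf (1 : ZMod p) a e := by
  have : Fact (1 < p) := ⟨by omega⟩
  by_cases hex : ∃ a : ZMod p, a + a = 1
  · obtain ⟨a, ha⟩ := hex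
    exact ⟨a, 2, one_ne_zero, .inr ⟨rfl, ha⟩, fun b hb =>
      ⟨by linear_combination a * hb - b * ha, rfl⟩⟩
  · exact ⟨1, 1, one_ne_zero, .inl ⟨rfl, rfl⟩, fun b hb => (hex ⟨b, hb⟩).elim⟩

open Filter Topology in
lemma exists_tendsto_countSym (hp : 3 ≤ p) {i : ℕ} (hi : 1 ≤ i) (hcop : i.Coprime p) :
    ∃ V : ℝ, 0 < V ∧
      Tendsto (fun n : ℕ => (countSym p (i + n * p) : ℝ) / (n : ℝ) ^ (p / 2)) atTop (𝓝 V) := by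
  have hpR : (0 : ℝ) < p := by exact_mod_cast Nat.pos_of_ne_zero (NeZero.ne p)
  have hτ : ∀ τ : ZMod p, ∃ V : ℝ, 0 ≤ V ∧ ((∃ a e, IsHalf τ a e) → 0 < V) ∧
      Tendsto (fun n : ℕ => ((symKunz p (i + n * p) τ).ncard : ℝ) /
        ((i + n * p : ℕ) : ℝ) ^ (p / 2)) atTop (𝓝 V) := by
    intro τ
    by_cases h : ∃ a e, IsHalf τ a e
    · obtain ⟨a, e, h⟩ := h
      obtain ⟨V, hV, hlim⟩ := h.tendsto_ncard_symKunz hi hcop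
      exact ⟨V, hV.le, fun _ => hV, hlim⟩
    · refine ⟨0, le_rfl, fun h' => (h h').elim, ?_⟩
      simp [symKunz_eq_empty_of_not_isHalf hp h]
  choose V hV hVpos hlim using hτ
  have hratio : Tendsto (fun n : ℕ => (((i + n * p : ℕ) : ℝ) / n) ^ (p / 2)) atTop
      (𝓝 ((p : ℝ) ^ (p / 2))) := by
    refine Tendsto.pow ?_ _
    have h1 := (tendsto_const_div_atTop_nhds_zero_nat (i : ℝ)).add_const (p : ℝ)
    rw [zero_add] at h1
    refine h1.congr' ?_
    filter_upwards [eventually_ne_atTop 0] with n hn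
    have hn' : (n : ℝ) ≠ 0 := by exact_mod_cast hn
    push_cast
    field_simp
  refine ⟨(∑ τ, V τ) * (p : ℝ) ^ (p / 2), mul_pos (sum_pos' (fun τ _ => hV τ)
    ⟨1, mem_univ _, hVpos 1 (exists_isHalf_one hp)⟩) (by positivity), ?_⟩
  refine ((tendsto_finsetSum univ fun τ _ => hlim τ).mul hratio).congr' ?_
  filter_upwards [eventually_ne_atTop 0] with n hn
  have hq : ((i + n * p : ℕ) : ℝ) ≠ 0 := by
    exact_mod_cast (show i + n * p ≠ 0 by omega)
  rw [countSym_eq_sum (by simpa using hcop), Nat.cast_sum, ← sum_div, div_pow,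
    div_mul_div_cancel₀ (pow_ne_zero _ hq)]

end

end

/-- For `i ∈ {1,…,p-1}` coprime to `p`, the function `n ↦ Sym(p, i+np)` is a
quasi-polynomial of degree `⌊p/2⌋` whose leading coefficient is constant. -/
theorem countSym_quasiPolynomial
    (p : ℕ) (hp : 3 ≤ p) (i : ℕ) (hi1 : 1 ≤ i) (hi2 : i ≤ p - 1)
    (hcop : Nat.Coprime i p) :
    ∃ (N : ℕ) (c : ℕ → Polynomial ℝ) (a : ℝ), 0 < N ∧
      (∀ k < N, (c k).degree ≤ ((p / 2 : ℕ) : WithBot ℕ)) ∧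
      (∃ k < N, (c k).degree = ((p / 2 : ℕ) : WithBot ℕ)) ∧
      (∀ k < N, (c k).coeff (p / 2) = a) ∧
      (∀ n : ℕ, (countSym p (i + n * p) : ℝ) = (c (n % N)).eval (n : ℝ)) := by
  have : NeZero p := ⟨by omega⟩
  obtain ⟨N, c, hc⟩ := exists_isConstituents_countSym hi1 hcop
  obtain ⟨a, ha, hlim⟩ := exists_tendsto_countSym hp hi1 hcop
  have hdeg := fun k (hk : k < N) => hc.degree_le_and_coeff_eq hlim hk
  refine ⟨N, c, a, hc.1, fun k hk => (hdeg k hk).1, ⟨0, hc.1, ?_⟩, fun k hk => (hdeg k hk).2, hc.2⟩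
  exact (hdeg 0 hc.1).1.antisymm (Polynomial.le_degree_of_ne_zero ((hdeg 0 hc.1).2 ▸ ha.ne'))
end

section
/- Let p, q, p̃, q̃ be integers with 3 ≤ p < q, 3 ≤ p̃ < q̃, gcd(p,q) = 1, gcd(p̃,q̃) = 1, p ≤ p̃ and q ≤ q̃. Then N(p,q) ≤ N(p̃,q̃): the number of numerical semigroups containing both p and q is at most the number of numerical semigroups containing both p̃ and q̃. -/
/-- `N p q`: the number of numerical semigroups containing both `p` and `q`. -/
noncomputable def countNS (p q : ℕ) : ℕ :=
  {H : Set ℕ | IsNumericalSemigroup H ∧ p ∈ H ∧ q ∈ H}.ncard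

/-- The pairs `(a, b)` of positive integers for which `p * q - a * p - b * q` lies in `H`. -/
def gapPairs (p q : ℕ) (H : Set ℕ) : Set (ℕ × ℕ) :=
  {x | 1 ≤ x.1 ∧ 1 ≤ x.2 ∧ ∃ m ∈ H, m + x.1 * p + x.2 * q = p * q}

/-- The set of combinations of `p` and `q`, together with the numbers `p * q - a * p - b * q`
for `(a, b) ∈ L`. -/
def ofGapPairs (p q : ℕ) (L : Set (ℕ × ℕ)) : Set ℕ :=
  {n | (∃ i j, n = i * p + j * q) ∨ ∃ a b, (a, b) ∈ L ∧ n + a * p + b * q = p * q}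

theorem exists_combination_or_gap {p q : ℕ} (hp : 0 < p) (hq : 0 < q) (h : Nat.Coprime p q)
    (n : ℕ) : (∃ i j, n = i * p + j * q) ∨
      ∃ a b, 1 ≤ a ∧ 1 ≤ b ∧ n + a * p + b * q = p * q := by
  obtain ⟨k, hk0, hkn⟩ := Nat.chineseRemainder h 0 n
  have hk : Nat.ModEq q (k % (p * q)) n := (Nat.mod_mul_left_mod k p q).trans hkn
  obtain ⟨i, hi⟩ : p ∣ k % (p * q) :=
    (Nat.dvd_mod_iff (Dvd.intro q rfl)).2 ((Nat.modEq_zero_iff_dvd).1 hk0)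
  have hlt : k % (p * q) < p * q := Nat.mod_lt _ (by positivity)
  rw [hi] at hk hlt
  have hiq : i < q := Nat.lt_of_mul_lt_mul_left hlt
  obtain hle | hgt := le_or_gt (p * i) n
  · obtain ⟨j, hj⟩ := (Nat.modEq_iff_dvd' hle).1 hk
    left
    refine ⟨i, j, ?_⟩
    rw [mul_comm i p, mul_comm j q, ← hj]
    omega
  · obtain ⟨c, hc⟩ := (Nat.modEq_iff_dvd' hgt.le).1 hk.symm
    right
    obtain ⟨d, rfl⟩ := Nat.exists_eq_add_of_lt hiq
    refine ⟨d + 1, c, by omega, ?_, ?_⟩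
    · rcases Nat.eq_zero_or_pos c with rfl | hc'
      · omega
      · exact hc'
    · have : p * i = n + (i + d + 1) * c := by omega
      linarith

theorem mul_add_mul_ne_mul {p q a b : ℕ} (h : Nat.Coprime p q) (ha : 1 ≤ a) (hb : 1 ≤ b) :
    a * p + b * q ≠ p * q := fun he ↦
  Nat.Coprime.mul_add_mul_ne_mul h (by omega) (by omega) he

theorem eq_and_eq_of_mul_add_mul_eq {p q a b c d n : ℕ} (h : Nat.Coprime p q) (hp : 0 < p)
    (ha : 1 ≤ a) (hb : 1 ≤ b) (hc : 1 ≤ c) (hd : 1 ≤ d)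
    (h₁ : n + a * p + b * q = p * q) (h₂ : n + c * p + d * q = p * q) : a = c ∧ b = d := by
  obtain rfl | hq := Nat.eq_zero_or_pos q
  · nlinarith
  wlog hac : a ≤ c generalizing a b c d
  · exact (this hc hd ha hb h₂ h₁ (by omega)).imp Eq.symm Eq.symm
  obtain ⟨e, rfl⟩ := Nat.exists_eq_add_of_le hac
  have hdvd : q ∣ e * p := by
    rw [← Nat.dvd_add_left (Dvd.intro_left d rfl)]
    exact Dvd.intro_left b (by linarith)
  obtain ⟨f, rfl⟩ := h.symm.dvd_of_dvd_mul_right hdvd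
  have hf : f = 0 := by
    by_contra hf
    have : 1 ≤ f := by omega
    nlinarith [Nat.mul_le_mul_right (p * q) this, Nat.mul_pos hp hq]
  subst hf
  refine ⟨by simp, Nat.eq_of_mul_eq_mul_right hq (by linarith)⟩

theorem IsNumericalSemigroup.add_combination_mem {H : Set ℕ} (hH : IsNumericalSemigroup H)
    {p q m : ℕ} (hp : p ∈ H) (hq : q ∈ H) (hm : m ∈ H) (i j : ℕ) : m + i * p + j * q ∈ H := by
  have h : ∀ r ∈ H, ∀ x ∈ H, ∀ k : ℕ, x + k * r ∈ H := by
    intro r hr x hx k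
    induction k with
    | zero => simpa using hx
    | succ k ih =>
      rw [add_mul, one_mul, ← add_assoc]
      exact hH.2.1 _ ih _ hr
  exact h q hq _ (h p hp m hm i) j

theorem IsNumericalSemigroup.combination_mem {H : Set ℕ} (hH : IsNumericalSemigroup H)
    {p q : ℕ} (hp : p ∈ H) (hq : q ∈ H) (i j : ℕ) : i * p + j * q ∈ H := by
  simpa using hH.add_combination_mem hp hq hH.1 i j

theorem exists_combination_of_mul_le {p q n : ℕ} (hp : 0 < p) (hq : 0 < q)
    (h : Nat.Coprime p q) (hn : p * q ≤ n) : ∃ i j, n = i * p + j * q := by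
  refine (exists_combination_or_gap hp hq h n).resolve_right ?_
  rintro ⟨a, b, ha, hb, he⟩
  have := Nat.mul_pos ha hp
  omega

/-- A numerical semigroup containing `p` and `q` is recovered from its gap pairs. -/
theorem ofGapPairs_gapPairs {p q : ℕ} (hp : 0 < p) (hq : 0 < q) (h : Nat.Coprime p q)
    {H : Set ℕ} (hH : IsNumericalSemigroup H) (hpH : p ∈ H) (hqH : q ∈ H) :
    ofGapPairs p q (gapPairs p q H) = H := by
  ext n
  constructor
  · rintro (⟨i, j, rfl⟩ | ⟨a, b, ⟨-, -, m, hm, he⟩, he'⟩)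
    · exact hH.combination_mem hpH hqH i j
    · obtain rfl : n = m := by dsimp only at he; omega
      exact hm
  · intro hn
    exact (exists_combination_or_gap hp hq h n).imp_right
      fun ⟨a, b, ha, hb, he⟩ ↦ ⟨a, b, ⟨ha, hb, n, hn, he⟩, he⟩

/-- Gap pairs for `p, q` that fit below the line of `p', q'` are recovered. -/
theorem gapPairs_ofGapPairs {p q : ℕ} (hp : 0 < p) (h : Nat.Coprime p q)
    {L : Set (ℕ × ℕ)} (hL : ∀ a b, (a, b) ∈ L → 1 ≤ a ∧ 1 ≤ b ∧ a * p + b * q ≤ p * q) :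
    gapPairs p q (ofGapPairs p q L) = L := by
  ext ⟨a, b⟩
  constructor
  · rintro ⟨ha, hb, m, ⟨i, j, rfl⟩ | ⟨c, d, hcd, he'⟩, he⟩
    · refine (mul_add_mul_ne_mul (a := i + a) (b := j + b) h (by omega) (by omega) ?_).elim
      dsimp only at he
      linarith
    · obtain ⟨hc, hd, -⟩ := hL c d hcd
      obtain ⟨rfl, rfl⟩ := eq_and_eq_of_mul_add_mul_eq h hp ha hb hc hd he he'
      exact hcd
  · intro hab
    obtain ⟨ha, hb, hle⟩ := hL a b hab
    have he : p * q - (a * p + b * q) + a * p + b * q = p * q := by omega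
    exact ⟨ha, hb, _, Or.inr ⟨a, b, hab, he⟩, he⟩

theorem le_and_le_of_add_eq_mul {p q a b m : ℕ} (hp : 0 < p) (hq : 0 < q)
    (he : m + a * p + b * q = p * q) : a ≤ q ∧ b ≤ p :=
  ⟨Nat.le_of_mul_le_mul_right (by rw [mul_comm q p]; omega) hp,
    Nat.le_of_mul_le_mul_right (by omega) hq⟩

theorem mul_add_mul_le_of_mem_gapPairs {p q p' q' : ℕ} (hp : 0 < p) (hq : 0 < q) (hpp : p ≤ p')
    (hqq : q ≤ q') {H : Set ℕ} {a b : ℕ} (hab : (a, b) ∈ gapPairs p q H) :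
    a * p' + b * q' ≤ p' * q' := by
  obtain ⟨ha, hb, m, -, he⟩ := hab
  dsimp only at ha hb he
  obtain ⟨haq, hbp⟩ := le_and_le_of_add_eq_mul hp hq he
  have hle : a * p + b * q ≤ p * q := by omega
  obtain ⟨s, rfl⟩ := Nat.exists_eq_add_of_le hpp
  obtain ⟨t, rfl⟩ := Nat.exists_eq_add_of_le hqq
  nlinarith [Nat.mul_le_mul_right s haq, Nat.mul_le_mul_right t hbp]

/-- The gap pairs for `p, q` of a numerical semigroup define a numerical semigroup
for `p' ≥ p` and `q' ≥ q`. -/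
theorem isNumericalSemigroup_ofGapPairs {p q p' q' : ℕ} (hp' : 0 < p') (hq' : 0 < q')
    (h' : Nat.Coprime p' q') (hpp : p ≤ p') (hqq : q ≤ q') {H : Set ℕ}
    (hH : IsNumericalSemigroup H) (hpH : p ∈ H) (hqH : q ∈ H) :
    IsNumericalSemigroup (ofGapPairs p' q' (gapPairs p q H)) := by
  have mixed : ∀ i j, ∀ y ∈ ofGapPairs p' q' (gapPairs p q H),
      i * p' + j * q' + y ∈ ofGapPairs p' q' (gapPairs p q H) := by
    rintro i j y (⟨k, l, rfl⟩ | ⟨c, d, ⟨hc, hd, m, hm, he⟩, hy⟩)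
    · exact Or.inl ⟨i + k, j + l, by ring⟩
    dsimp only at hc hd he
    obtain ⟨hcq, hdp⟩ := le_and_le_of_add_eq_mul hp' hq' hy
    by_cases hci : c ≤ i
    · obtain ⟨e, rfl⟩ := Nat.exists_eq_add_of_le hci
      obtain ⟨f, rfl⟩ := Nat.exists_eq_add_of_le hdp
      exact Or.inl ⟨e, f + j, by linarith⟩
    by_cases hdj : d ≤ j
    · obtain ⟨e, rfl⟩ := Nat.exists_eq_add_of_le hdj
      obtain ⟨f, rfl⟩ := Nat.exists_eq_add_of_le hcq
      exact Or.inl ⟨f + i, e, by linarith⟩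
    obtain ⟨e, rfl⟩ := Nat.exists_eq_add_of_le (not_le.1 hci).le
    obtain ⟨f, rfl⟩ := Nat.exists_eq_add_of_le (not_le.1 hdj).le
    refine Or.inr ⟨e, f, ⟨by dsimp only; omega, by dsimp only; omega, m + i * p + j * q,
      hH.add_combination_mem hpH hqH hm i j, ?_⟩, ?_⟩
    · dsimp only; linarith
    · linarith
  refine ⟨Or.inl ⟨0, 0, by simp⟩, ?_, ?_⟩
  · intro x hx y hy
    obtain ⟨i, j, rfl⟩ | ⟨a, b, ⟨ha, hb, m, hm, he⟩, hxe⟩ := id hx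
    · exact mixed i j y hy
    obtain ⟨i, j, rfl⟩ | ⟨c, d, ⟨hc, hd, n, hn, hf⟩, hye⟩ := id hy
    · rw [add_comm]
      exact mixed i j x hx
    dsimp only at ha hb he hc hd hf
    obtain ⟨s, rfl⟩ := Nat.exists_eq_add_of_le hpp
    obtain ⟨t, rfl⟩ := Nat.exists_eq_add_of_le hqq
    have hmn := hH.2.1 m hm n hn
    by_cases hac : q + t < a + c
    · obtain ⟨e, he'⟩ := Nat.exists_eq_add_of_lt hac
      refine Or.inr ⟨e + 1, b + d, ⟨by dsimp only; omega, by dsimp only; omega,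
        m + n + t * p + 0 * q, hH.add_combination_mem hpH hqH hmn t 0, ?_⟩, ?_⟩
      · dsimp only
        linear_combination he + hf - p * he'
      · linear_combination hxe + hye - (p + s) * he'
    by_cases hbd : p + s < b + d
    · obtain ⟨e, he'⟩ := Nat.exists_eq_add_of_lt hbd
      refine Or.inr ⟨a + c, e + 1, ⟨by dsimp only; omega, by dsimp only; omega,
        m + n + 0 * p + s * q, hH.add_combination_mem hpH hqH hmn 0 s, ?_⟩, ?_⟩
      · dsimp only
        linear_combination he + hf - q * he'
      · linear_combination hxe + hye - (q + t) * he'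
    obtain ⟨e, he'⟩ := Nat.exists_eq_add_of_le (not_lt.1 hac)
    obtain ⟨f, hf'⟩ := Nat.exists_eq_add_of_le (not_lt.1 hbd)
    refine Or.inl ⟨e, f, ?_⟩
    zify at *
    linear_combination hxe + hye + (p + s : ℤ) * he' + (q + t : ℤ) * hf'
  · refine (Set.finite_Iio (p' * q')).subset fun n hn ↦ ?_
    by_contra hle
    exact hn (Or.inl (exists_combination_of_mul_le hp' hq' h' (not_lt.1 hle)))

theorem finite_numericalSemigroups {p q : ℕ} (hp : 0 < p) (hq : 0 < q) (h : Nat.Coprime p q) :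
    {H : Set ℕ | IsNumericalSemigroup H ∧ p ∈ H ∧ q ∈ H}.Finite := by
  refine Set.Finite.of_finite_image (f := compl)
    ((Set.finite_Iio (p * q)).finite_subsets.subset ?_) compl_injective.injOn
  rintro _ ⟨H, ⟨hH, hpH, hqH⟩, rfl⟩ n hn
  by_contra hle
  obtain ⟨i, j, rfl⟩ := exists_combination_of_mul_le hp hq h (not_lt.1 hle)
  exact hn (hH.combination_mem hpH hqH i j)

/-- Monotonicity of `N(p,q)` in `p` and `q`. -/
theorem countNS_mono
    (p q p' q' : ℕ) (hp : 3 ≤ p) (hpq : p < q) (hp' : 3 ≤ p') (hpq' : p' < q')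
    (hcop : Nat.Coprime p q) (hcop' : Nat.Coprime p' q')
    (hpp : p ≤ p') (hqq : q ≤ q') :
    countNS p q ≤ countNS p' q' := by
  have hp0 : 0 < p := by omega
  have hq0 : 0 < q := by omega
  have hp0' : 0 < p' := by omega
  have hq0' : 0 < q' := by omega
  have hinv : ∀ H : Set ℕ,
      gapPairs p' q' (ofGapPairs p' q' (gapPairs p q H)) = gapPairs p q H := fun H ↦
    gapPairs_ofGapPairs hp0' hcop' fun a b hab ↦
      ⟨hab.1, hab.2.1, mul_add_mul_le_of_mem_gapPairs hp0 hq0 hpp hqq hab⟩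
  refine Set.ncard_le_ncard_of_injOn (fun H ↦ ofGapPairs p' q' (gapPairs p q H)) ?_ ?_
    (finite_numericalSemigroups hp0' hq0' hcop')
  · rintro H ⟨hH, hpH, hqH⟩
    exact ⟨isNumericalSemigroup_ofGapPairs hp0' hq0' hcop' hpp hqq hH hpH hqH,
      Or.inl ⟨1, 0, by simp⟩, Or.inl ⟨0, 1, by simp⟩⟩
  · rintro H ⟨hH, hpH, hqH⟩ K ⟨hK, hpK, hqK⟩ he
    have hg : gapPairs p q H = gapPairs p q K := by
      rw [← hinv H, ← hinv K]
      exact congrArg _ he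
    rw [← ofGapPairs_gapPairs hp0 hq0 hcop hH hpH hqH, hg,
      ofGapPairs_gapPairs hp0 hq0 hcop hK hpK hqK]
end

section
/- For every integer q ≥ 4 with gcd(q,3) = 1 one has Sym(3,q) = Sym(3, q−3) + 2 if q is even and Sym(3,q) = Sym(3, q−3) + 1 if q is odd; and Psym(3,q) = Psym(3, q−3) + 1 if q is even and Psym(3,q) = Psym(3, q−3) + 2 if q is odd. Here Sym(3,q) (resp. Psym(3,q)) is the number of symmetric (resp. pseudo-symmetric) numerical semigroups containing both 3 and q. -/
/-- `H` is pseudo-symmetric if `2 g(H) = F(H) + 2`. -/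
def IsPseudoSymmetricNS (H : Set ℕ) : Prop := 2 * (genus H : ℤ) = frobNum H + 2

/-- `Psym p q`: the number of pseudo-symmetric numerical semigroups containing both
`p` and `q`. -/
noncomputable def countPsym (p q : ℕ) : ℕ :=
  {H : Set ℕ | IsNumericalSemigroup H ∧ p ∈ H ∧ q ∈ H ∧ IsPseudoSymmetricNS H}.ncard

/-- The set of `n` divisible by `3`, or `≡ 1 [MOD 3]` and at least `3 * a + 1`,
or `≡ 2 [MOD 3]` and at least `3 * b + 2`. -/
def threeSet (a b : ℕ) : Set ℕ :=
  {n | n % 3 = 0 ∨ (n % 3 = 1 ∧ 3 * a + 1 ≤ n) ∨ (n % 3 = 2 ∧ 3 * b + 2 ≤ n)}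

theorem mem_threeSet {a b n : ℕ} : n ∈ threeSet a b ↔
    n % 3 = 0 ∨ (n % 3 = 1 ∧ 3 * a + 1 ≤ n) ∨ (n % 3 = 2 ∧ 3 * b + 2 ≤ n) := Iff.rfl

theorem threeSet_injective : Function.Injective (fun p : ℕ × ℕ => threeSet p.1 p.2) := by
  rintro ⟨a, b⟩ ⟨c, d⟩ h
  have key : ∀ n, n ∈ threeSet a b ↔ n ∈ threeSet c d := fun n => by
    simpa using Set.ext_iff.1 h n
  simp only [mem_threeSet] at key
  have h1 := key (3 * a + 1)
  have h2 := key (3 * c + 1)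
  have h3 := key (3 * b + 2)
  have h4 := key (3 * d + 2)
  rw [Prod.mk.injEq]
  omega

theorem compl_threeSet (a b : ℕ) : (threeSet a b)ᶜ =
    (((Finset.range a).image (fun i => 3 * i + 1) ∪
      (Finset.range b).image (fun i => 3 * i + 2) : Finset ℕ) : Set ℕ) := by
  ext n
  simp only [Set.mem_compl_iff, mem_threeSet, Finset.coe_union, Finset.coe_image, Set.mem_union,
    Set.mem_image, Finset.mem_coe, Finset.mem_range]
  constructor
  · intro h
    rcases (by omega : n % 3 = 1 ∨ n % 3 = 2) with h1 | h1
    · exact Or.inl ⟨n / 3, by omega, by omega⟩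
    · exact Or.inr ⟨n / 3, by omega, by omega⟩
  · rintro (⟨i, hi, rfl⟩ | ⟨i, hi, rfl⟩) <;> omega

theorem genus_threeSet (a b : ℕ) : genus (threeSet a b) = a + b := by
  rw [genus, compl_threeSet, Set.ncard_coe_finset, Finset.card_union_of_disjoint,
    Finset.card_image_of_injective, Finset.card_image_of_injective, Finset.card_range,
    Finset.card_range]
  · intro x y h
    simp only at h
    omega
  · intro x y h
    simp only at h
    omega
  · rw [Finset.disjoint_left]
    simp only [Finset.mem_image, Finset.mem_range]
    rintro n ⟨i, hi, rfl⟩ ⟨j, hj, h⟩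
    omega

theorem frobNum_threeSet (a b : ℕ) :
    frobNum (threeSet a b) = max (3 * a - 2 : ℤ) (3 * b - 1) := by
  refine IsGreatest.csSup_eq ⟨?_, ?_⟩
  · by_cases h : b < a
    · refine Or.inr ⟨3 * a - 2, ?_, ?_⟩
      · rw [Set.mem_compl_iff, mem_threeSet]
        omega
      · simp only
        omega
    · by_cases hb : b = 0
      · left
        omega
      · refine Or.inr ⟨3 * b - 1, ?_, ?_⟩
        · rw [Set.mem_compl_iff, mem_threeSet]
          omega
        · simp only
          omega
  · rintro x (rfl | ⟨n, hn, rfl⟩)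
    · omega
    · rw [Set.mem_compl_iff, mem_threeSet] at hn
      simp only
      omega

theorem isNumericalSemigroup_threeSet {a b : ℕ} (h₁ : b ≤ 2 * a) (h₂ : a ≤ 2 * b + 1) :
    IsNumericalSemigroup (threeSet a b) := by
  refine ⟨Or.inl rfl, fun x hx y hy => ?_, ?_⟩
  · rw [mem_threeSet] at *
    omega
  · rw [compl_threeSet]
    exact Finset.finite_toSet _

theorem IsNumericalSemigroup.add_three_mul_mem {H : Set ℕ} (hH : IsNumericalSemigroup H)
    (h3 : 3 ∈ H) {n : ℕ} (hn : n ∈ H) (k : ℕ) : n + 3 * k ∈ H := by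
  induction k with
  | zero => exact hn
  | succ k ih => exact hH.2.1 _ ih _ h3

theorem IsNumericalSemigroup.exists_three_mul_add_mem_iff {H : Set ℕ}
    (hH : IsNumericalSemigroup H) (h3 : 3 ∈ H) (r : ℕ) :
    ∃ a, ∀ i, 3 * i + r ∈ H ↔ a ≤ i := by
  classical
  have hex : ∃ i, 3 * i + r ∈ H := by
    by_contra! hcon
    refine Set.infinite_of_injective_forall_mem (s := Hᶜ) (f := fun i : ℕ => 3 * i + r) ?_ hcon
      hH.2.2
    intro x y h
    simp only at h
    omega
  refine ⟨Nat.find hex, fun i => ⟨fun h => Nat.find_min' hex h, fun h => ?_⟩⟩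
  have := hH.add_three_mul_mem h3 (Nat.find_spec hex) (i - Nat.find hex)
  rwa [show 3 * Nat.find hex + r + 3 * (i - Nat.find hex) = 3 * i + r by omega] at this

theorem IsNumericalSemigroup.exists_eq_threeSet {H : Set ℕ} (hH : IsNumericalSemigroup H)
    (h3 : 3 ∈ H) : ∃ a b, b ≤ 2 * a ∧ a ≤ 2 * b + 1 ∧ H = threeSet a b := by
  obtain ⟨a, ha⟩ := hH.exists_three_mul_add_mem_iff h3 1
  obtain ⟨b, hb⟩ := hH.exists_three_mul_add_mem_iff h3 2
  refine ⟨a, b, ?_, ?_, ?_⟩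
  · have h := (ha a).2 le_rfl
    rw [← hb]
    convert hH.2.1 _ h _ h using 1
    ring
  · have h := (hb b).2 le_rfl
    rw [← ha]
    convert hH.2.1 _ h _ h using 1
    ring
  · ext n
    rw [mem_threeSet]
    rcases (by omega : n % 3 = 0 ∨ n % 3 = 1 ∨ n % 3 = 2) with h | h | h
    · have := hH.add_three_mul_mem h3 hH.1 (n / 3)
      rw [show 0 + 3 * (n / 3) = n by omega] at this
      simp [this, h]
    · have := ha (n / 3)
      rw [show 3 * (n / 3) + 1 = n by omega] at this
      rw [this]
      omega
    · have := hb (n / 3)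
      rw [show 3 * (n / 3) + 2 = n by omega] at this
      rw [this]
      omega

theorem countSym_three (q : ℕ) : countSym 3 q =
    {p : ℕ × ℕ | (p.2 = 2 * p.1 ∨ p.1 = 2 * p.2 + 1) ∧ q ∈ threeSet p.1 p.2}.ncard := by
  rw [countSym, ← Set.ncard_image_of_injective _ threeSet_injective]
  congr 1
  ext H
  constructor
  · rintro ⟨hH, h3, hq, hs⟩
    obtain ⟨a, b, h₁, h₂, rfl⟩ := hH.exists_eq_threeSet h3
    rw [IsSymmetricNS, genus_threeSet, frobNum_threeSet] at hs
    refine ⟨(a, b), ⟨?_, hq⟩, rfl⟩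
    push_cast at hs
    simp only
    omega
  · rintro ⟨⟨a, b⟩, ⟨h, hq⟩, rfl⟩
    simp only at h
    refine ⟨isNumericalSemigroup_threeSet (by omega) (by omega), Or.inl rfl, hq, ?_⟩
    rw [IsSymmetricNS, genus_threeSet, frobNum_threeSet]
    push_cast
    omega

theorem countPsym_three (q : ℕ) : countPsym 3 q =
    {p : ℕ × ℕ | (p.2 + 1 = 2 * p.1 ∨ p.1 = 2 * p.2 ∧ 0 < p.1) ∧
      q ∈ threeSet p.1 p.2}.ncard := by
  rw [countPsym, ← Set.ncard_image_of_injective _ threeSet_injective]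
  congr 1
  ext H
  constructor
  · rintro ⟨hH, h3, hq, hs⟩
    obtain ⟨a, b, h₁, h₂, rfl⟩ := hH.exists_eq_threeSet h3
    rw [IsPseudoSymmetricNS, genus_threeSet, frobNum_threeSet] at hs
    refine ⟨(a, b), ⟨?_, hq⟩, rfl⟩
    push_cast at hs
    simp only
    omega
  · rintro ⟨⟨a, b⟩, ⟨h, hq⟩, rfl⟩
    simp only at h
    refine ⟨isNumericalSemigroup_threeSet (by omega) (by omega), Or.inl rfl, hq, ?_⟩
    rw [IsPseudoSymmetricNS, genus_threeSet, frobNum_threeSet]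
    push_cast
    omega

theorem finite_setOf_mem_threeSet {q : ℕ} (hq : q % 3 ≠ 0) (P : ℕ × ℕ → Prop)
    (hP : ∀ p, P p → p.2 ≤ 2 * p.1 ∧ p.1 ≤ 2 * p.2 + 1) :
    {p : ℕ × ℕ | P p ∧ q ∈ threeSet p.1 p.2}.Finite := by
  refine (Set.finite_Iic ((2 * q + 1, 2 * q + 1) : ℕ × ℕ)).subset ?_
  rintro ⟨a, b⟩ ⟨h, hm⟩
  have := hP _ h
  rw [mem_threeSet] at hm
  simp only at this hm
  rw [Set.mem_Iic, Prod.mk_le_mk]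
  omega

theorem ncard_setOf_mem_threeSet_add_one {q : ℕ} (hq : 4 ≤ q) (hq3 : q % 3 ≠ 0)
    (P : ℕ × ℕ → Prop) (hP : ∀ p, P p → p.2 ≤ 2 * p.1 ∧ p.1 ≤ 2 * p.2 + 1) (x : ℕ × ℕ)
    (hx : ∀ p, (P p ∧ q ∈ threeSet p.1 p.2 ∧ q - 3 ∉ threeSet p.1 p.2) ↔ p = x) :
    {p : ℕ × ℕ | P p ∧ q ∈ threeSet p.1 p.2}.ncard =
      {p : ℕ × ℕ | P p ∧ q - 3 ∈ threeSet p.1 p.2}.ncard + 1 := by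
  have hfin := finite_setOf_mem_threeSet (q := q - 3) (by omega) P hP
  have hnot : x ∉ {p : ℕ × ℕ | P p ∧ q - 3 ∈ threeSet p.1 p.2} :=
    fun h => ((hx x).2 rfl).2.2 h.2
  rw [← Set.ncard_insert_of_notMem hnot hfin]
  congr 1
  ext p
  have hmono : q - 3 ∈ threeSet p.1 p.2 → q ∈ threeSet p.1 p.2 := by
    simp only [mem_threeSet]
    omega
  have := hx p
  simp only [Set.mem_insert_iff, Set.mem_ofPred_eq]
  grind

theorem ncard_setOf_mem_threeSet_add_two {q : ℕ} (hq : 4 ≤ q) (hq3 : q % 3 ≠ 0)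
    (P : ℕ × ℕ → Prop) (hP : ∀ p, P p → p.2 ≤ 2 * p.1 ∧ p.1 ≤ 2 * p.2 + 1) (x y : ℕ × ℕ)
    (hxy : x ≠ y)
    (hx : ∀ p, (P p ∧ q ∈ threeSet p.1 p.2 ∧ q - 3 ∉ threeSet p.1 p.2) ↔ p = x ∨ p = y) :
    {p : ℕ × ℕ | P p ∧ q ∈ threeSet p.1 p.2}.ncard =
      {p : ℕ × ℕ | P p ∧ q - 3 ∈ threeSet p.1 p.2}.ncard + 2 := by
  have hfin := finite_setOf_mem_threeSet (q := q - 3) (by omega) P hP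
  have hy : y ∉ {p : ℕ × ℕ | P p ∧ q - 3 ∈ threeSet p.1 p.2} :=
    fun h => ((hx y).2 (Or.inr rfl)).2.2 h.2
  have hx' : x ∉ insert y {p : ℕ × ℕ | P p ∧ q - 3 ∈ threeSet p.1 p.2} := by
    rintro (h | h)
    · exact hxy h
    · exact ((hx x).2 (Or.inl rfl)).2.2 h.2
  rw [show ∀ n, n + 2 = n + 1 + 1 from fun _ => rfl, ← Set.ncard_insert_of_notMem hy hfin,
    ← Set.ncard_insert_of_notMem hx' (hfin.insert y)]
  congr 1
  ext p
  have hmono : q - 3 ∈ threeSet p.1 p.2 → q ∈ threeSet p.1 p.2 := by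
    simp only [mem_threeSet]
    omega
  have := hx p
  simp only [Set.mem_insert_iff, Set.mem_ofPred_eq]
  grind

/-- Recursion formulas for `Sym(3,q)` and `Psym(3,q)`, `q ≥ 4` coprime to `3`. -/
theorem countSym_countPsym_three_recursion (q : ℕ) (hq : 4 ≤ q) (hcop : Nat.Coprime q 3) :
    (Even q → countSym 3 q = countSym 3 (q - 3) + 2) ∧
    (Odd q → countSym 3 q = countSym 3 (q - 3) + 1) ∧
    (Even q → countPsym 3 q = countPsym 3 (q - 3) + 1) ∧
    (Odd q → countPsym 3 q = countPsym 3 (q - 3) + 2) := by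
  have hmod : q % 3 = 1 ∨ q % 3 = 2 := by
    have : ¬ 3 ∣ q := (Nat.Prime.coprime_iff_not_dvd Nat.prime_three).1 hcop.symm
    omega
  refine ⟨?_, ?_, ?_, ?_⟩
  · intro hpar
    rw [Nat.even_iff] at hpar
    rw [countSym_three, countSym_three]
    rcases hmod with h | h
    · refine ncard_setOf_mem_threeSet_add_two hq (by omega) _ (fun p hp => by omega)
        (q / 3, 2 * (q / 3)) (q / 3, q / 3 / 2) (by rw [Ne, Prod.mk.injEq]; omega) ?_
      rintro ⟨a, b⟩
      simp only [mem_threeSet, Prod.mk.injEq]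
      omega
    · refine ncard_setOf_mem_threeSet_add_two hq (by omega) _ (fun p hp => by omega)
        (q / 3 / 2, q / 3) (2 * (q / 3) + 1, q / 3) (by rw [Ne, Prod.mk.injEq]; omega) ?_
      rintro ⟨a, b⟩
      simp only [mem_threeSet, Prod.mk.injEq]
      omega
  · intro hpar
    rw [Nat.odd_iff] at hpar
    rw [countSym_three, countSym_three]
    rcases hmod with h | h
    · refine ncard_setOf_mem_threeSet_add_one hq (by omega) _ (fun p hp => by omega)
        (q / 3, 2 * (q / 3)) ?_
      rintro ⟨a, b⟩
      simp only [mem_threeSet, Prod.mk.injEq]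
      omega
    · refine ncard_setOf_mem_threeSet_add_one hq (by omega) _ (fun p hp => by omega)
        (2 * (q / 3) + 1, q / 3) ?_
      rintro ⟨a, b⟩
      simp only [mem_threeSet, Prod.mk.injEq]
      omega
  · intro hpar
    rw [Nat.even_iff] at hpar
    rw [countPsym_three, countPsym_three]
    rcases hmod with h | h
    · refine ncard_setOf_mem_threeSet_add_one hq (by omega) _ (fun p hp => by omega)
        (q / 3, 2 * (q / 3) - 1) ?_
      rintro ⟨a, b⟩
      simp only [mem_threeSet, Prod.mk.injEq]
      omega
    · refine ncard_setOf_mem_threeSet_add_one hq (by omega) _ (fun p hp => by omega)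
        (2 * (q / 3), q / 3) ?_
      rintro ⟨a, b⟩
      simp only [mem_threeSet, Prod.mk.injEq]
      omega
  · intro hpar
    rw [Nat.odd_iff] at hpar
    rw [countPsym_three, countPsym_three]
    rcases hmod with h | h
    · refine ncard_setOf_mem_threeSet_add_two hq (by omega) _ (fun p hp => by omega)
        (q / 3, 2 * (q / 3) - 1) (q / 3, q / 3 / 2) (by rw [Ne, Prod.mk.injEq]; omega) ?_
      rintro ⟨a, b⟩
      simp only [mem_threeSet, Prod.mk.injEq]
      omega
    · refine ncard_setOf_mem_threeSet_add_two hq (by omega) _ (fun p hp => by omega)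
        (2 * (q / 3), q / 3) ((q / 3 + 1) / 2, q / 3) (by rw [Ne, Prod.mk.injEq]; omega) ?_
      rintro ⟨a, b⟩
      simp only [mem_threeSet, Prod.mk.injEq]
      omega
end

section
/- As q → ∞ along integers coprime to 3, both N(3,q)/q² → 1/12 and Medim(3,q)/q² → 1/12; i.e. for every ε > 0 there is Q such that for all q ≥ Q with gcd(q,3) = 1 one has |N(3,q)/q² − 1/12| < ε and |Medim(3,q)/q² − 1/12| < ε. -/
/-- The embedding dimension: cardinality of the minimal generating set
`(H∖{0}) ∖ ((H∖{0}) + (H∖{0}))`. -/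
noncomputable def edim (H : Set ℕ) : ℕ :=
  ((H \ {0}) \ {n | ∃ a ∈ H \ {0}, ∃ b ∈ H \ {0}, n = a + b}).ncard

/-- The multiplicity: smallest positive element. -/
noncomputable def mult (H : Set ℕ) : ℕ := sInf {n | n ∈ H ∧ 0 < n}

/-- `Medim p q`: the number of numerical semigroups of maximal embedding
dimension `p` (i.e. `m(H) = edim(H) = p`) containing `q`. -/
noncomputable def countMaxEdim (p q : ℕ) : ℕ :=
  {H : Set ℕ | IsNumericalSemigroup H ∧ mult H = p ∧ edim H = p ∧ q ∈ H}.ncard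

/-- The set of naturals that are multiples of `3`, or `1` mod `3` and at least `3 * x + 1`, or
`2` mod `3` and at least `3 * y + 2`. -/
def kunzSet (x y : ℕ) : Set ℕ :=
  {n | n % 3 = 0 ∨ n % 3 = 1 ∧ x ≤ n / 3 ∨ n % 3 = 2 ∧ y ≤ n / 3}

lemma mem_kunzSet {x y n : ℕ} :
    n ∈ kunzSet x y ↔ n % 3 = 0 ∨ n % 3 = 1 ∧ x ≤ n / 3 ∨ n % 3 = 2 ∧ y ≤ n / 3 :=
  Iff.rfl

lemma kunzSet_inj {x y x' y' : ℕ} (h : kunzSet x y = kunzSet x' y') : x = x' ∧ y = y' := by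
  have key (n : ℕ) : n ∈ kunzSet x y ↔ n ∈ kunzSet x' y' := by rw [h]
  simp only [mem_kunzSet] at key
  have h₁ := key (3 * x + 1)
  have h₂ := key (3 * x' + 1)
  have h₃ := key (3 * y + 2)
  have h₄ := key (3 * y' + 2)
  omega

lemma isNumericalSemigroup_kunzSet {x y : ℕ} (hy : y ≤ 2 * x) (hx : x ≤ 2 * y + 1) :
    IsNumericalSemigroup (kunzSet x y) := by
  refine ⟨by simp [mem_kunzSet], fun a ha b hb => ?_, ?_⟩
  · rw [mem_kunzSet] at *
    omega
  · refine (Set.finite_lt_nat (3 * x + 3 * y + 3)).subset fun n hn => ?_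
    rw [Set.mem_compl_iff, mem_kunzSet] at hn
    rw [Set.mem_ofPred_eq]
    omega

/-- Every numerical semigroup containing `3` is a `kunzSet`. -/
lemma IsNumericalSemigroup.exists_eq_kunzSet {H : Set ℕ} (hH : IsNumericalSemigroup H)
    (h3 : 3 ∈ H) : ∃ x y, y ≤ 2 * x ∧ x ≤ 2 * y + 1 ∧ H = kunzSet x y := by
  classical
  obtain ⟨h0, hadd, hfin⟩ := hH
  obtain ⟨M, hM⟩ := hfin.bddAbove
  have hlarge (n : ℕ) (hn : M < n) : n ∈ H := by
    by_contra h
    exact hn.not_ge (hM h)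
  have hmul (a k : ℕ) (ha : a ∈ H) : a + 3 * k ∈ H := by
    induction k with
    | zero => simpa using ha
    | succ k ih => exact hadd _ ih _ h3
  have e₁ : ∃ x, 3 * x + 1 ∈ H := ⟨M, hlarge _ (by omega)⟩
  have e₂ : ∃ y, 3 * y + 2 ∈ H := ⟨M, hlarge _ (by omega)⟩
  have hx := Nat.find_spec e₁
  have hy := Nat.find_spec e₂
  have hx_min (m : ℕ) (hm : 3 * m + 1 ∈ H) : Nat.find e₁ ≤ m := Nat.find_min' e₁ hm
  have hy_min (m : ℕ) (hm : 3 * m + 2 ∈ H) : Nat.find e₂ ≤ m := Nat.find_min' e₂ hm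
  generalize Nat.find e₁ = x at *
  generalize Nat.find e₂ = y at *
  refine ⟨x, y, hy_min _ ?_, hx_min _ ?_, Set.ext fun n => ?_⟩
  · convert hadd _ hx _ hx using 1
    ring
  · convert hadd _ hy _ hy using 1
    ring
  · rw [mem_kunzSet]
    constructor
    · intro hn
      have : n % 3 = 0 ∨ n % 3 = 1 ∨ n % 3 = 2 := by omega
      rcases this with h | h | h
      · exact Or.inl h
      · exact Or.inr (Or.inl ⟨h, hx_min _ (by convert hn using 1; omega)⟩)
      · exact Or.inr (Or.inr ⟨h, hy_min _ (by convert hn using 1; omega)⟩)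
    · rintro (h | ⟨h, hle⟩ | ⟨h, hle⟩)
      · convert hmul 0 (n / 3) h0 using 1
        omega
      · convert hmul _ (n / 3 - x) hx using 1
        omega
      · convert hmul _ (n / 3 - y) hy using 1
        omega

lemma mult_kunzSet {x y : ℕ} (hx : 0 < x) (hy : 0 < y) : mult (kunzSet x y) = 3 := by
  refine IsLeast.csInf_eq ⟨by simp [mem_kunzSet], fun n hn => ?_⟩
  rw [Set.mem_ofPred_eq, mem_kunzSet] at hn
  omega

lemma edim_kunzSet {x y : ℕ} (hy : y < 2 * x) (hx : x ≤ 2 * y) : edim (kunzSet x y) = 3 := by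
  have hgen : (kunzSet x y \ {0}) \
      {n | ∃ a ∈ kunzSet x y \ {0}, ∃ b ∈ kunzSet x y \ {0}, n = a + b} =
      {3, 3 * x + 1, 3 * y + 2} := by
    ext n
    simp only [Set.mem_sdiff, Set.mem_singleton_iff, Set.mem_ofPred_eq, Set.mem_insert_iff,
      mem_kunzSet]
    constructor
    · rintro ⟨hn, hsum⟩
      by_contra hne
      exact hsum ⟨3, by omega, n - 3, by omega, by omega⟩
    · intro hn
      refine ⟨by omega, ?_⟩
      rintro ⟨a, ha, b, hb, hab⟩
      omega
  rw [edim, hgen, Set.ncard_eq_three]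
  exact ⟨3, 3 * x + 1, 3 * y + 2, by omega, by omega, by omega, rfl⟩

lemma exists_eq_three_mul_add {q : ℕ} (hq : Nat.Coprime q 3) :
    ∃ k, q = 3 * k + 1 ∨ q = 3 * k + 2 := by
  have hq3 : q % 3 ≠ 0 := fun h => by
    simpa using hq.symm.eq_one_of_dvd (Nat.dvd_of_mod_eq_zero h)
  exact ⟨q / 3, by omega⟩

lemma finite_setOf_isNumericalSemigroup_three_mem {q : ℕ} (hq : Nat.Coprime q 3) :
    {H : Set ℕ | IsNumericalSemigroup H ∧ 3 ∈ H ∧ q ∈ H}.Finite := by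
  obtain ⟨k, hk⟩ := exists_eq_three_mul_add hq
  refine (((Set.finite_Iic (2 * q + 1)).prod (Set.finite_Iic (2 * q + 1))).image
    fun p : ℕ × ℕ => kunzSet p.1 p.2).subset ?_
  rintro H ⟨hH, h3, hqH⟩
  obtain ⟨x, y, hy, hx, rfl⟩ := hH.exists_eq_kunzSet h3
  rw [mem_kunzSet] at hqH
  exact ⟨(x, y), ⟨Set.mem_Iic.2 (by omega), Set.mem_Iic.2 (by omega)⟩, rfl⟩

/-- A set of positive multiplicity contains its multiplicity. -/
lemma mem_of_mult_eq {H : Set ℕ} {m : ℕ} (h : mult H = m) (hm : 0 < m) : m ∈ H := by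
  subst h
  exact (Nat.sInf_mem (Nat.nonempty_of_pos_sInf hm)).1

lemma setOf_maxEdim_three_subset (q : ℕ) :
    {H : Set ℕ | IsNumericalSemigroup H ∧ mult H = 3 ∧ edim H = 3 ∧ q ∈ H} ⊆
      {H : Set ℕ | IsNumericalSemigroup H ∧ 3 ∈ H ∧ q ∈ H} :=
  fun _ ⟨hH, hm, _, hqH⟩ => ⟨hH, mem_of_mult_eq hm three_pos, hqH⟩

lemma countMaxEdim_three_le_countNS {q : ℕ} (hq : Nat.Coprime q 3) :
    countMaxEdim 3 q ≤ countNS 3 q :=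
  Set.ncard_le_ncard (setOf_maxEdim_three_subset q)
    (finite_setOf_isNumericalSemigroup_three_mem hq)

lemma countNS_three_le_card {ι : Type*} {q : ℕ} (s : Finset ι) (f : ι → ℕ × ℕ)
    (h : ∀ x y, y ≤ 2 * x → x ≤ 2 * y + 1 → q ∈ kunzSet x y → ∃ i ∈ s, f i = (x, y)) :
    countNS 3 q ≤ s.card := by
  classical
  rw [← Set.ncard_coe_finset s]
  refine le_trans (Set.ncard_le_ncard ?_ (s.finite_toSet.image _))
    (Set.ncard_image_le (f := fun i => kunzSet (f i).1 (f i).2) s.finite_toSet)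
  rintro H ⟨hH, h3, hqH⟩
  obtain ⟨x, y, hy, hx, rfl⟩ := hH.exists_eq_kunzSet h3
  obtain ⟨i, hi, hf⟩ := h x y hy hx hqH
  exact ⟨i, hi, by simp [hf]⟩

lemma card_le_countMaxEdim_three {ι : Type*} {q : ℕ} (hq : Nat.Coprime q 3) (s : Finset ι)
    (f : ι → ℕ × ℕ) (hf : Function.Injective f)
    (h : ∀ i ∈ s, (f i).2 < 2 * (f i).1 ∧ (f i).1 ≤ 2 * (f i).2 ∧
      q ∈ kunzSet (f i).1 (f i).2) :
    s.card ≤ countMaxEdim 3 q := by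
  have hinj : Function.Injective fun i => kunzSet (f i).1 (f i).2 := fun i j hij =>
    hf (Prod.ext (kunzSet_inj hij).1 (kunzSet_inj hij).2)
  rw [← Set.ncard_coe_finset s, ← Set.ncard_image_of_injective _ hinj]
  refine Set.ncard_le_ncard ?_ ((finite_setOf_isNumericalSemigroup_three_mem hq).subset
    (setOf_maxEdim_three_subset q))
  rintro _ ⟨i, hi, rfl⟩
  obtain ⟨hy, hx, hqi⟩ := h i hi
  exact ⟨isNumericalSemigroup_kunzSet (by omega) (by omega),
    mult_kunzSet (by omega) (by omega), edim_kunzSet hy hx, hqi⟩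

lemma three_mul_sq_le_four_mul_sum {g : ℕ → ℕ} (hg : ∀ n, 3 * n ≤ 2 * g n + 1) (k : ℕ) :
    3 * k ^ 2 + k ≤ 4 * ∑ n ∈ Finset.range (k + 1), g n + 2 := by
  induction k with
  | zero => simp
  | succ k ih =>
    rw [Finset.sum_range_succ]
    nlinarith [hg (k + 1)]

lemma four_mul_sum_le {g : ℕ → ℕ} (hg : ∀ n, 2 * g n ≤ 3 * n + 4) (k : ℕ) :
    4 * ∑ n ∈ Finset.range (k + 1), g n ≤ 3 * k ^ 2 + 11 * k + 8 := by
  induction k with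
  | zero => simpa using (by linarith [hg 0] : 4 * g 0 ≤ 8)
  | succ k ih =>
    rw [Finset.sum_range_succ]
    nlinarith [hg (k + 1)]

lemma twelve_mul_countNS_three_le {q : ℕ} (hq : Nat.Coprime q 3) :
    12 * countNS 3 q ≤ q ^ 2 + 36 * q := by
  obtain ⟨k, rfl | rfl⟩ := exists_eq_three_mul_add hq
  · have h := countNS_three_le_card (q := 3 * k + 1)
      ((Finset.range (k + 1)).sigma fun x => Finset.Icc (x / 2) (2 * x))
      (fun p => (p.1, p.2)) fun x y hy hx hmem => by
        rw [mem_kunzSet] at hmem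
        refine ⟨⟨x, y⟩, ?_, rfl⟩
        simp only [Finset.mem_sigma, Finset.mem_range, Finset.mem_Icc]
        omega
    rw [Finset.card_sigma] at h
    have := four_mul_sum_le (g := fun x => (Finset.Icc (x / 2) (2 * x)).card)
      (fun n => by rw [Nat.card_Icc]; omega) k
    nlinarith
  · have h := countNS_three_le_card (q := 3 * k + 2)
      ((Finset.range (k + 1)).sigma fun y => Finset.Icc ((y + 1) / 2) (2 * y + 1))
      (fun p => (p.2, p.1)) fun x y hy hx hmem => by
        rw [mem_kunzSet] at hmem
        refine ⟨⟨y, x⟩, ?_, rfl⟩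
        simp only [Finset.mem_sigma, Finset.mem_range, Finset.mem_Icc]
        omega
    rw [Finset.card_sigma] at h
    have := four_mul_sum_le (g := fun y => (Finset.Icc ((y + 1) / 2) (2 * y + 1)).card)
      (fun n => by rw [Nat.card_Icc]; omega) k
    nlinarith

lemma sq_le_twelve_mul_countMaxEdim_three {q : ℕ} (hq : Nat.Coprime q 3) :
    q ^ 2 ≤ 12 * countMaxEdim 3 q + 12 * q := by
  obtain ⟨k, rfl | rfl⟩ := exists_eq_three_mul_add hq
  · have h := card_le_countMaxEdim_three hq
      ((Finset.range (k + 1)).sigma fun x => Finset.Ico ((x + 1) / 2) (2 * x))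
      (fun p => (p.1, p.2)) (fun ⟨_, _⟩ ⟨_, _⟩ h => by simpa using h) fun ⟨x, y⟩ hp => by
        simp only [Finset.mem_sigma, Finset.mem_range, Finset.mem_Ico] at hp
        simp only [mem_kunzSet]
        omega
    rw [Finset.card_sigma] at h
    have := three_mul_sq_le_four_mul_sum
      (g := fun x => (Finset.Ico ((x + 1) / 2) (2 * x)).card)
      (fun n => by rw [Nat.card_Ico]; omega) k
    nlinarith
  · have h := card_le_countMaxEdim_three hq
      ((Finset.range (k + 1)).sigma fun y => Finset.Ioc (y / 2) (2 * y))
      (fun p => (p.2, p.1)) (fun ⟨_, _⟩ ⟨_, _⟩ h => by simpa [and_comm] using h)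
      fun ⟨y, x⟩ hp => by
        simp only [Finset.mem_sigma, Finset.mem_range, Finset.mem_Ioc] at hp
        simp only [mem_kunzSet]
        omega
    rw [Finset.card_sigma] at h
    have := three_mul_sq_le_four_mul_sum (g := fun y => (Finset.Ioc (y / 2) (2 * y)).card)
      (fun n => by rw [Nat.card_Ioc]; omega) k
    nlinarith

lemma abs_div_sq_sub_lt {q ε c : ℝ} (hq : 0 < q) (hε : 3 < ε * q)
    (hl : q ^ 2 ≤ 12 * c + 12 * q) (hu : 12 * c ≤ q ^ 2 + 36 * q) :
    |c / q ^ 2 - 1 / 12| < ε := by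
  have hq2 : 0 < q ^ 2 := by positivity
  have key : 3 * q < ε * q ^ 2 := by nlinarith
  have heq : c / q ^ 2 - 1 / 12 = (c - q ^ 2 / 12) / q ^ 2 := by
    field_simp
  rw [heq, abs_div, abs_of_pos hq2, div_lt_iff₀ hq2, abs_lt]
  constructor <;> linarith

/-- `N(3,q)/q² → 1/12` and `Medim(3,q)/q² → 1/12` as `q → ∞` along integers
coprime to `3`. -/
theorem countNS_countMaxEdim_three_limit :
    ∀ ε : ℝ, 0 < ε → ∃ Q : ℕ, ∀ q : ℕ, Q ≤ q → Nat.Coprime q 3 →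
      |(countNS 3 q : ℝ) / (q : ℝ) ^ 2 - 1 / 12| < ε ∧
      |(countMaxEdim 3 q : ℝ) / (q : ℝ) ^ 2 - 1 / 12| < ε := by
  intro ε hε
  obtain ⟨Q, hQ⟩ := exists_nat_gt (3 / ε)
  refine ⟨Q, fun q hQq hq => ?_⟩
  have hqε : 3 / ε < (q : ℝ) := hQ.trans_le (by exact_mod_cast hQq)
  have hq0 : (0 : ℝ) < q := lt_trans (by positivity) hqε
  have hbig : 3 < ε * q := by rwa [div_lt_iff₀' hε] at hqε
  have hl : (q : ℝ) ^ 2 ≤ 12 * countMaxEdim 3 q + 12 * q := by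
    exact_mod_cast sq_le_twelve_mul_countMaxEdim_three hq
  have hu : 12 * (countNS 3 q : ℝ) ≤ (q : ℝ) ^ 2 + 36 * q := by
    exact_mod_cast twelve_mul_countNS_three_le hq
  have hle : (countMaxEdim 3 q : ℝ) ≤ countNS 3 q := by
    exact_mod_cast countMaxEdim_three_le_countNS hq
  exact ⟨abs_div_sq_sub_lt hq0 hbig (by linarith) hu,
    abs_div_sq_sub_lt hq0 hbig hl (by linarith)⟩
end
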